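/- A 7-dimensional indecomposable 2-step real nilpotent Lie algebra admits a purely coclosed G2-structure if and only if it is not isomorphic to the Lie algebra 27A (structure equations de⁶ = e^{12}, de⁷ = e^{14}+e^{35}, all other de^i = 0) nor to the Lie algebra 27B (structure equations de⁶ = e^{12}+e^{34}, de⁷ = e^{15}+e^{23}, all other de^i = 0). (Theorem '2step-indecomposable-pure' of the paper.) -/

import Mathlib

set_option synthInstance.maxHeartbeats 1000000
set_option maxHeartbeats 1000000

open ExteriorAlgebra Module

noncomputable section

/-- The degree-`k` homogeneous component of the exterior algebra of `V`. -/
def degPart (V : Type*) [AddCommGroup V] [Module ℝ V] (k : ℕ) :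
    Submodule ℝ (ExteriorAlgebra ℝ V) :=
  LinearMap.range (ExteriorAlgebra.ι ℝ : V →ₗ[ℝ] ExteriorAlgebra ℝ V) ^ k

/-- `c` is the interior product (contraction) with the vector `X : V`, acting on the exterior
algebra `Λ V*` of the dual of `V`: it is an odd antiderivation which on a 1-form `α` gives the
scalar `α(X)`. -/
def IsContraction {V : Type*} [AddCommGroup V] [Module ℝ V] (X : V)
    (c : ExteriorAlgebra ℝ (Dual ℝ V) →ₗ[ℝ] ExteriorAlgebra ℝ (Dual ℝ V)) : Prop :=
  (∀ k, ∀ x ∈ degPart (Dual ℝ V) k, ∀ y,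
      c (x * y) = c x * y + ((-1 : ℝ)) ^ k • (x * c y)) ∧
  (∀ α : Dual ℝ V, c (ExteriorAlgebra.ι ℝ α) = algebraMap ℝ _ (α X))

variable {g : Type*} [LieRing g] [LieAlgebra ℝ g]

/-- `d` is the Chevalley–Eilenberg differential of `g` on `Λ g*`, expressed with respect to a
basis `b` of `g`: it raises degree by one, is an odd derivation, and on 1-forms it is given by
`dα = -Σ_{i<j} α([b i, b j]) bⁱ ∧ bʲ` (which encodes `dα(x,y) = -α([x,y])`). -/
def IsCEDifferential {n : ℕ} (b : Basis (Fin n) ℝ g)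
    (d : ExteriorAlgebra ℝ (Dual ℝ g) →ₗ[ℝ] ExteriorAlgebra ℝ (Dual ℝ g)) : Prop :=
  (∀ k, ∀ x ∈ degPart (Dual ℝ g) k, d x ∈ degPart (Dual ℝ g) (k + 1)) ∧
  (∀ k, ∀ x ∈ degPart (Dual ℝ g) k, ∀ y,
      d (x * y) = d x * y + ((-1 : ℝ)) ^ k • (x * d y)) ∧
  (∀ α : Dual ℝ g, d (ExteriorAlgebra.ι ℝ α) =
    (-(2⁻¹ : ℝ)) • ∑ i, ∑ j, α ⁅b i, b j⁆ •
      (ExteriorAlgebra.ι ℝ (b.dualBasis i) * ExteriorAlgebra.ι ℝ (b.dualBasis j)))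

/-- The 4-form `∗φ = e^{1234}+e^{1256}+e^{1367}+e^{1457}+e^{2357}-e^{2467}+e^{3456}` built out
of a family `f` of seven 1-forms (indexed from 0). -/
def starPhiForm {W : Type*} [AddCommGroup W] [Module ℝ W] (f : Fin 7 → W) :
    ExteriorAlgebra ℝ W :=
  let e : Fin 7 → ExteriorAlgebra ℝ W := fun i => ExteriorAlgebra.ι ℝ (f i)
  e 0 * e 1 * e 2 * e 3 + e 0 * e 1 * e 4 * e 5 + e 0 * e 2 * e 5 * e 6 +
    e 0 * e 3 * e 4 * e 6 + e 1 * e 2 * e 4 * e 6 - e 1 * e 3 * e 5 * e 6 +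
    e 2 * e 3 * e 4 * e 5

/-- The 3-form `φ = e^{127}+e^{347}+e^{567}+e^{135}-e^{146}-e^{236}-e^{245}` built out of a
family `f` of seven 1-forms (indexed from 0). -/
def phiG2Form {W : Type*} [AddCommGroup W] [Module ℝ W] (f : Fin 7 → W) :
    ExteriorAlgebra ℝ W :=
  let e : Fin 7 → ExteriorAlgebra ℝ W := fun i => ExteriorAlgebra.ι ℝ (f i)
  e 0 * e 1 * e 6 + e 2 * e 3 * e 6 + e 4 * e 5 * e 6 + e 0 * e 2 * e 4 -
    e 0 * e 3 * e 5 - e 1 * e 2 * e 5 - e 1 * e 3 * e 4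

/-- A 7-dimensional real Lie algebra admits a coclosed G₂-structure if there is a basis
`f¹,…,f⁷` of `g*` for which the 4-form `∗φ` is closed for the Chevalley–Eilenberg
differential. -/
def AdmitsCoclosedG2 (g : Type*) [LieRing g] [LieAlgebra ℝ g] : Prop :=
  ∃ (b : Basis (Fin 7) ℝ g)
    (d : ExteriorAlgebra ℝ (Dual ℝ g) →ₗ[ℝ] ExteriorAlgebra ℝ (Dual ℝ g)),
    IsCEDifferential b d ∧
    ∃ f : Basis (Fin 7) ℝ (Dual ℝ g), d (starPhiForm fun i => f i) = 0

/-- A 7-dimensional real Lie algebra admits a purely coclosed G₂-structure if there is a basis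
`f¹,…,f⁷` of `g*` for which `∗φ` is closed and moreover `φ ∧ dφ = 0`. -/
def AdmitsPurelyCoclosedG2 (g : Type*) [LieRing g] [LieAlgebra ℝ g] : Prop :=
  ∃ (b : Basis (Fin 7) ℝ g)
    (d : ExteriorAlgebra ℝ (Dual ℝ g) →ₗ[ℝ] ExteriorAlgebra ℝ (Dual ℝ g)),
    IsCEDifferential b d ∧
    ∃ f : Basis (Fin 7) ℝ (Dual ℝ g),
      d (starPhiForm fun i => f i) = 0 ∧
      (phiG2Form fun i => f i) * d (phiG2Form fun i => f i) = 0

/-- A Lie algebra is decomposable if it is the direct sum of two nonzero ideals. -/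
def Decomposable (g : Type*) [LieRing g] [LieAlgebra ℝ g] : Prop :=
  ∃ I J : LieIdeal ℝ g, I ≠ ⊥ ∧ J ≠ ⊥ ∧ I ⊓ J = ⊥ ∧ I ⊔ J = ⊤

/-- Shorthand for the 1-form `eⁱ` (the `i`-th dual basis vector) in `Λ g*`. -/
def ef {g : Type*} [LieRing g] [LieAlgebra ℝ g] (b : Basis (Fin 7) ℝ g) (i : Fin 7) :
    ExteriorAlgebra ℝ (Dual ℝ g) :=
  ExteriorAlgebra.ι ℝ (b.dualBasis i)

/-- `g` has the structure equations of the Lie algebra `27A`: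
`de⁶ = e^{12}`, `de⁷ = e^{14} + e^{35}`, all other `deⁱ = 0`. -/
def HasStructure27A (g : Type*) [LieRing g] [LieAlgebra ℝ g] : Prop :=
  ∃ (b : Basis (Fin 7) ℝ g)
    (d : ExteriorAlgebra ℝ (Dual ℝ g) →ₗ[ℝ] ExteriorAlgebra ℝ (Dual ℝ g)),
    IsCEDifferential b d ∧
    (∀ i : Fin 7, i ≤ 4 → d (ef b i) = 0) ∧
    d (ef b 5) = ef b 0 * ef b 1 ∧
    d (ef b 6) = ef b 0 * ef b 3 + ef b 2 * ef b 4

/-- `g` has the structure equations of the Lie algebra `27B`: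
`de⁶ = e^{12} + e^{34}`, `de⁷ = e^{15} + e^{23}`, all other `deⁱ = 0`. -/
def HasStructure27B (g : Type*) [LieRing g] [LieAlgebra ℝ g] : Prop :=
  ∃ (b : Basis (Fin 7) ℝ g)
    (d : ExteriorAlgebra ℝ (Dual ℝ g) →ₗ[ℝ] ExteriorAlgebra ℝ (Dual ℝ g)),
    IsCEDifferential b d ∧
    (∀ i : Fin 7, i ≤ 4 → d (ef b i) = 0) ∧
    d (ef b 5) = ef b 0 * ef b 1 + ef b 2 * ef b 3 ∧
    d (ef b 6) = ef b 0 * ef b 4 + ef b 1 * ef b 2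

section Contraction

variable {V : Type*} [AddCommGroup V] [Module ℝ V]

/-- The interior product with the vector `X` on the exterior algebra of the dual space. -/
def contract (X : V) :
    ExteriorAlgebra ℝ (Dual ℝ V) →ₗ[ℝ] ExteriorAlgebra ℝ (Dual ℝ V) :=
  CliffordAlgebra.contractLeft (Dual.eval ℝ V X)

lemma contract_ι_mul (X : V) (α : Dual ℝ V) (y : ExteriorAlgebra ℝ (Dual ℝ V)) :
    contract X (ι ℝ α * y) = α X • y - ι ℝ α * contract X y :=
  CliffordAlgebra.contractLeft_ι_mul _ _ _

lemma contract_ι (X : V) (α : Dual ℝ V) :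
    contract X (ι ℝ α) = algebraMap ℝ _ (α X) :=
  CliffordAlgebra.contractLeft_ι _ _ _

lemma contract_algebraMap (X : V) (r : ℝ) :
    contract X (algebraMap ℝ (ExteriorAlgebra ℝ (Dual ℝ V)) r) = 0 :=
  CliffordAlgebra.contractLeft_algebraMap _ _ _

lemma contract_one (X : V) : contract X (1 : ExteriorAlgebra ℝ (Dual ℝ V)) = 0 :=
  CliffordAlgebra.contractLeft_one _ _

lemma contract_comm (X Y : V) (x : ExteriorAlgebra ℝ (Dual ℝ V)) :
    contract X (contract Y x) = -contract Y (contract X x) :=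
  CliffordAlgebra.contractLeft_comm _ _ _

lemma ι_mem_degPart (α : V) : ι ℝ α ∈ degPart V 1 := by
  rw [degPart, pow_one]
  exact ⟨α, rfl⟩

lemma mul_mem_degPart {k l : ℕ} {x y : ExteriorAlgebra ℝ V} (hx : x ∈ degPart V k)
    (hy : y ∈ degPart V l) : x * y ∈ degPart V (k + l) := by
  rw [degPart, pow_add]
  exact Submodule.mul_mem_mul hx hy

/-- To prove a property of homogeneous elements it is enough to treat scalars, sums, and left
multiplication by elements of degree one. -/
lemma degPart_induction {C : ℕ → ExteriorAlgebra ℝ V → Prop}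
    (scalar : ∀ r : ℝ, C 0 (algebraMap ℝ _ r))
    (add : ∀ k x y, C k x → C k y → C k (x + y))
    (ι_mul : ∀ k α x, x ∈ degPart V k → C k x → C (k + 1) (ι ℝ α * x))
    {k : ℕ} {x : ExteriorAlgebra ℝ V} (hx : x ∈ degPart V k) : C k x := by
  refine Submodule.pow_induction_on_left' (C := fun n x _ => C n x) _ scalar
    (fun x y i _ _ h h' => add i x y h h') ?_ hx
  rintro _ ⟨α, rfl⟩ i x hx h
  exact ι_mul i α x hx h

lemma contract_mem_degPart (X : V) {k : ℕ} {x : ExteriorAlgebra ℝ (Dual ℝ V)}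
    (hx : x ∈ degPart (Dual ℝ V) (k + 1)) : contract X x ∈ degPart (Dual ℝ V) k := by
  refine degPart_induction
    (C := fun n x => n = 0 ∧ contract X x = 0 ∨
      ∃ k, n = k + 1 ∧ contract X x ∈ degPart (Dual ℝ V) k) ?_ ?_ ?_ hx |>.elim (by simp) ?_
  · exact fun r => Or.inl ⟨rfl, contract_algebraMap _ _⟩
  · rintro n x y (⟨hn, h⟩ | ⟨k, hn, h⟩) (⟨hn', h'⟩ | ⟨k', hn', h'⟩)
    · exact Or.inl ⟨hn, by rw [map_add, h, h', add_zero]⟩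
    · omega
    · omega
    · obtain rfl : k = k' := by omega
      exact Or.inr ⟨k, hn, by rw [map_add]; exact add_mem h h'⟩
  · rintro n α x hx h
    refine Or.inr ⟨n, rfl, ?_⟩
    rw [contract_ι_mul]
    refine sub_mem (Submodule.smul_mem _ _ hx) ?_
    rcases h with ⟨-, h⟩ | ⟨k, rfl, h⟩
    · rw [h, mul_zero]
      exact zero_mem _
    · rw [add_comm k 1]
      exact mul_mem_degPart (ι_mem_degPart α) h
  · rintro ⟨l, hl, h⟩
    obtain rfl : k = l := by omega
    exact h

/-- The operator `∑ c k ∧ ι_{X k}` on the exterior algebra of the dual space. -/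
def wedgeContract {κ : Type*} [Fintype κ] (c : κ → ExteriorAlgebra ℝ (Dual ℝ V)) (X : κ → V) :
    ExteriorAlgebra ℝ (Dual ℝ V) →ₗ[ℝ] ExteriorAlgebra ℝ (Dual ℝ V) :=
  ∑ k, LinearMap.mulLeft ℝ (c k) ∘ₗ contract (X k)

variable {κ : Type*} [Fintype κ] {c : κ → ExteriorAlgebra ℝ (Dual ℝ V)} {X : κ → V}

lemma wedgeContract_apply (x : ExteriorAlgebra ℝ (Dual ℝ V)) :
    wedgeContract c X x = ∑ k, c k * contract (X k) x := by
  simp [wedgeContract]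

lemma wedgeContract_algebraMap (r : ℝ) : wedgeContract c X (algebraMap ℝ _ r) = 0 := by
  simp [wedgeContract_apply, contract_algebraMap]

lemma wedgeContract_ι (α : Dual ℝ V) : wedgeContract c X (ι ℝ α) = ∑ k, α (X k) • c k := by
  simp [wedgeContract_apply, contract_ι, Algebra.smul_def, Algebra.commutes]

lemma wedgeContract_ι_mul (hc : ∀ k x, Commute (c k) x) (α : Dual ℝ V)
    (y : ExteriorAlgebra ℝ (Dual ℝ V)) :
    wedgeContract c X (ι ℝ α * y) =
      wedgeContract c X (ι ℝ α) * y - ι ℝ α * wedgeContract c X y := by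
  rw [wedgeContract_ι, wedgeContract_apply, wedgeContract_apply, Finset.sum_mul, Finset.mul_sum,
    ← Finset.sum_sub_distrib]
  refine Finset.sum_congr rfl fun k _ => ?_
  rw [contract_ι_mul, mul_sub, mul_smul_comm, smul_mul_assoc, ← mul_assoc, (hc k (ι ℝ α)).eq,
    mul_assoc]

lemma wedgeContract_mem_degPart (hc : ∀ k, c k ∈ degPart (Dual ℝ V) 2) {n : ℕ}
    {x : ExteriorAlgebra ℝ (Dual ℝ V)} (hx : x ∈ degPart (Dual ℝ V) n) :
    wedgeContract c X x ∈ degPart (Dual ℝ V) (n + 1) := by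
  rcases n with - | n
  · rw [degPart, pow_zero, Submodule.mem_one] at hx
    obtain ⟨r, rfl⟩ := hx
    rw [wedgeContract_algebraMap]
    exact zero_mem _
  · rw [wedgeContract_apply]
    refine sum_mem fun k _ => ?_
    have := mul_mem_degPart (hc k) (contract_mem_degPart (X k) hx)
    rwa [show 2 + n = n + 1 + 1 by ring] at this

lemma wedgeContract_mul (hc : ∀ k x, Commute (c k) x) {n : ℕ}
    {x : ExteriorAlgebra ℝ (Dual ℝ V)} (hx : x ∈ degPart (Dual ℝ V) n)
    (y : ExteriorAlgebra ℝ (Dual ℝ V)) :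
    wedgeContract c X (x * y) =
      wedgeContract c X x * y + ((-1 : ℝ)) ^ n • (x * wedgeContract c X y) := by
  refine degPart_induction (C := fun n x => wedgeContract c X (x * y) =
    wedgeContract c X x * y + ((-1 : ℝ)) ^ n • (x * wedgeContract c X y)) ?_ ?_ ?_ hx
  · intro r
    rw [wedgeContract_algebraMap, ← Algebra.smul_def, ← Algebra.smul_def, map_smul]
    simp
  · intro k x x' h h'
    rw [add_mul, map_add, h, h', map_add, add_mul, add_mul, smul_add]
    abel
  · intro k α x _ h
    rw [mul_assoc, wedgeContract_ι_mul hc, h, wedgeContract_ι_mul hc α x, sub_mul, mul_add,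
      mul_smul_comm, pow_succ, mul_neg_one, neg_smul, mul_assoc, mul_assoc, mul_assoc]
    abel

end Contraction

lemma commute_ι_mul_ι {W : Type*} [AddCommGroup W] [Module ℝ W] (α β : W)
    (x : ExteriorAlgebra ℝ W) : Commute (ι ℝ α * ι ℝ β) x := by
  have anti (a b : W) : ι ℝ a * ι ℝ b = -(ι ℝ b * ι ℝ a) :=
    eq_neg_of_add_eq_zero_left (ι_add_mul_swap a b)
  induction x using ExteriorAlgebra.induction with
  | algebraMap r => exact (Algebra.commutes r _).symm
  | ι γ =>
    rw [commute_iff_eq, mul_assoc, anti β γ, mul_neg, ← mul_assoc, anti α γ, neg_mul, neg_neg,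
      mul_assoc]
  | mul x y hx hy => exact hx.mul_right hy
  | add x y hx hy => exact hx.add_right hy

section CEDifferential

variable {n : ℕ} (b : Basis (Fin n) ℝ g)

/-- The Chevalley–Eilenberg differential on 1-forms. -/
def ceOneForm : Dual ℝ g →ₗ[ℝ] ExteriorAlgebra ℝ (Dual ℝ g) :=
  (-(2⁻¹ : ℝ)) • ∑ i, ∑ j, (Dual.eval ℝ g ⁅b i, b j⁆).smulRight
    (ι ℝ (b.dualBasis i) * ι ℝ (b.dualBasis j))

lemma ceOneForm_apply (α : Dual ℝ g) : ceOneForm b α =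
    (-(2⁻¹ : ℝ)) • ∑ i, ∑ j, α ⁅b i, b j⁆ • (ι ℝ (b.dualBasis i) * ι ℝ (b.dualBasis j)) := by
  simp [ceOneForm]

lemma commute_ceOneForm (α : Dual ℝ g) (x : ExteriorAlgebra ℝ (Dual ℝ g)) :
    Commute (ceOneForm b α) x := by
  rw [ceOneForm_apply]
  exact (Commute.sum_left _ _ _ fun _ _ => Commute.sum_left _ _ _ fun _ _ =>
    (commute_ι_mul_ι _ _ _).smul_left _).smul_left _

lemma ceOneForm_mem_degPart (α : Dual ℝ g) : ceOneForm b α ∈ degPart (Dual ℝ g) 2 := by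
  rw [ceOneForm_apply]
  exact Submodule.smul_mem _ _ <| sum_mem fun _ _ => sum_mem fun _ _ => Submodule.smul_mem _ _ <|
    mul_mem_degPart (ι_mem_degPart _) (ι_mem_degPart _)

lemma sum_apply_smul_coord (α : Dual ℝ g) : ∑ k, α (b k) • b.coord k = α := by
  refine b.ext fun i => ?_
  simp

/-- Contraction of `dα` with `X` is `-α([X, ·])`. -/
lemma contract_ceOneForm (X : g) (α : Dual ℝ g) :
    contract X (ceOneForm b α) = -ι ℝ (α ∘ₗ (LieAlgebra.ad ℝ g X : g →ₗ[ℝ] g)) := by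
  have key : ∑ i, ∑ j, (α ⁅b i, b j⁆ * b.coord i X) • b.coord j =
      α ∘ₗ (LieAlgebra.ad ℝ g X : g →ₗ[ℝ] g) := by
    conv_rhs => rw [← sum_apply_smul_coord b (α ∘ₗ (LieAlgebra.ad ℝ g X : g →ₗ[ℝ] g))]
    rw [Finset.sum_comm]
    refine Finset.sum_congr rfl fun j _ => ?_
    rw [← Finset.sum_smul]
    congr 1
    simp only [LinearMap.comp_apply, LieAlgebra.ad_apply]
    conv_rhs => rw [← b.sum_repr X, sum_lie, map_sum]
    simp [mul_comm]
  have key' : ∑ i, ∑ j, (α ⁅b i, b j⁆ * b.coord j X) • b.coord i =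
      -(α ∘ₗ (LieAlgebra.ad ℝ g X : g →ₗ[ℝ] g)) := by
    rw [← key, Finset.sum_comm]
    rw [← Finset.sum_neg_distrib]
    refine Finset.sum_congr rfl fun i _ => ?_
    rw [← Finset.sum_neg_distrib]
    refine Finset.sum_congr rfl fun j _ => ?_
    rw [← lie_skew, map_neg, neg_mul]
    module
  have : contract X (ceOneForm b α) = (-(2⁻¹ : ℝ)) •
      ι ℝ (∑ i, ∑ j, (α ⁅b i, b j⁆ * b.coord i X) • b.coord j -
        ∑ i, ∑ j, (α ⁅b i, b j⁆ * b.coord j X) • b.coord i) := by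
    rw [ceOneForm_apply]
    simp only [map_smul, map_sum, contract_ι_mul, contract_ι, map_sub, smul_sub,
      Finset.sum_sub_distrib, Basis.coe_dualBasis, mul_smul, ← Algebra.commutes, ← Algebra.smul_def]
  rw [this, key, key', ← map_smul, ← map_neg]
  congr 1
  module

/-- The Chevalley–Eilenberg differential, as the operator `∑ dbᵏ ∧ ι_{b k}`. -/
def ceDifferential : ExteriorAlgebra ℝ (Dual ℝ g) →ₗ[ℝ] ExteriorAlgebra ℝ (Dual ℝ g) :=
  wedgeContract (fun k => ceOneForm b (b.coord k)) b

lemma ceDifferential_ι (α : Dual ℝ g) : ceDifferential b (ι ℝ α) = ceOneForm b α := by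
  simp only [ceDifferential, wedgeContract_ι, ← map_smul, ← map_sum, sum_apply_smul_coord]

lemma isCEDifferential_ceDifferential : IsCEDifferential b (ceDifferential b) :=
  ⟨fun _ _ hx => wedgeContract_mem_degPart (fun _ => ceOneForm_mem_degPart b _) hx,
    fun _ _ hx y => wedgeContract_mul (fun _ => commute_ceOneForm b _) hx y,
    fun α => by rw [ceDifferential_ι, ceOneForm_apply]⟩

variable {b} {d : ExteriorAlgebra ℝ (Dual ℝ g) →ₗ[ℝ] ExteriorAlgebra ℝ (Dual ℝ g)}

lemma IsCEDifferential.map_ι (hd : IsCEDifferential b d) (α : Dual ℝ g) :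
    d (ι ℝ α) = ceOneForm b α := by
  rw [hd.2.2, ceOneForm_apply]

lemma IsCEDifferential.map_ι_mul (hd : IsCEDifferential b d) (α : Dual ℝ g)
    (y : ExteriorAlgebra ℝ (Dual ℝ g)) : d (ι ℝ α * y) = d (ι ℝ α) * y - ι ℝ α * d y := by
  rw [hd.2.1 1 _ (ι_mem_degPart α)]
  simp [sub_eq_add_neg]

lemma IsCEDifferential.map_one (hd : IsCEDifferential b d) : d 1 = 0 := by
  have := hd.2.1 0 1 (by simp [degPart]) 1
  simpa using this

/-- A Chevalley–Eilenberg differential is determined by its values on 1-forms. -/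
lemma IsCEDifferential.eq_wedgeContract (hd : IsCEDifferential b d) {κ : Type*} [Fintype κ]
    {c : κ → ExteriorAlgebra ℝ (Dual ℝ g)} {X : κ → g} (hc : ∀ k x, Commute (c k) x)
    (h : ∀ α, ceOneForm b α = ∑ k, α (X k) • c k) : d = wedgeContract c X := by
  refine LinearMap.ext fun x => ?_
  induction x using CliffordAlgebra.left_induction with
  | algebraMap r =>
    rw [Algebra.algebraMap_eq_smul_one, map_smul, hd.map_one, map_smul,
      ← _root_.map_one (algebraMap ℝ _),
      wedgeContract_algebraMap]
  | add x y hx hy => rw [map_add, map_add, hx, hy]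
  | ι_mul x α hx =>
    rw [hd.map_ι_mul, hx, hd.map_ι, h, ← wedgeContract_ι, ← wedgeContract_ι_mul hc]

end CEDifferential

section TwoDimensionalCenter

variable {V : Type*} [AddCommGroup V] [Module ℝ V]

lemma contract_mul (X : V) {n : ℕ} {x : ExteriorAlgebra ℝ (Dual ℝ V)}
    (hx : x ∈ degPart (Dual ℝ V) n) (y : ExteriorAlgebra ℝ (Dual ℝ V)) :
    contract X (x * y) = contract X x * y + ((-1 : ℝ)) ^ n • (x * contract X y) := by
  refine degPart_induction (C := fun n x => contract X (x * y) =
    contract X x * y + ((-1 : ℝ)) ^ n • (x * contract X y)) ?_ ?_ ?_ hx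
  · intro r
    rw [contract_algebraMap, ← Algebra.smul_def, ← Algebra.smul_def, map_smul]
    simp
  · intro k x x' h h'
    rw [add_mul, map_add, h, h', map_add, add_mul, add_mul, smul_add]
    abel
  · intro k α x _ h
    rw [mul_assoc, contract_ι_mul, h, contract_ι_mul, sub_mul, mul_add, smul_mul_assoc,
      mul_smul_comm, pow_succ, mul_neg_one, neg_smul, mul_assoc, mul_assoc]
    abel

/-- The `2 × 2` minor of `(p, q)` in columns `a, b`. -/
def minorTwo (p q : Fin 7 → ℝ) (a b : Fin 7) : ℝ := p a * q b - p b * q a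

/-- The `4 × 4` minor of `(p, q, r, s)` in columns `a, b, c, d`, expanded along two rows. -/
def minorFour (p q r s : Fin 7 → ℝ) (a b c d : Fin 7) : ℝ :=
  minorTwo p q a b * minorTwo r s c d - minorTwo p q a c * minorTwo r s b d +
    minorTwo p q a d * minorTwo r s b c + minorTwo p q b c * minorTwo r s a d -
    minorTwo p q b d * minorTwo r s a c + minorTwo p q c d * minorTwo r s a b

/-- The value of the standard 4-form `∗φ` on four coordinate vectors. -/
def starPhiValue (p q r s : Fin 7 → ℝ) : ℝ :=
  minorFour p q r s 0 1 2 3 + minorFour p q r s 0 1 4 5 + minorFour p q r s 0 2 5 6 +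
    minorFour p q r s 0 3 4 6 + minorFour p q r s 1 2 4 6 - minorFour p q r s 1 3 5 6 +
    minorFour p q r s 2 3 4 5

/-- The cross product on `ℝ⁷` defined by the standard 3-form `φ`. -/
def crossSeven (x y : Fin 7 → ℝ) : Fin 7 → ℝ :=
  ![x 1 * y 6 + x 2 * y 4 - x 3 * y 5 - x 4 * y 2 + x 5 * y 3 - x 6 * y 1,
    -x 0 * y 6 - x 2 * y 5 - x 3 * y 4 + x 4 * y 3 + x 5 * y 2 + x 6 * y 0,
    -x 0 * y 4 + x 1 * y 5 + x 3 * y 6 + x 4 * y 0 - x 5 * y 1 - x 6 * y 3,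
    x 0 * y 5 + x 1 * y 4 - x 2 * y 6 - x 4 * y 1 - x 5 * y 0 + x 6 * y 2,
    x 0 * y 2 - x 1 * y 3 - x 2 * y 0 + x 3 * y 1 + x 5 * y 6 - x 6 * y 5,
    -x 0 * y 3 - x 1 * y 2 + x 2 * y 1 + x 3 * y 0 - x 4 * y 6 + x 6 * y 4,
    x 0 * y 1 - x 1 * y 0 + x 2 * y 3 - x 3 * y 2 + x 4 * y 5 - x 5 * y 4]

lemma contract_four (X Y Z W : V) (f : Fin 7 → Dual ℝ V) (a b c d : Fin 7) :
    contract W (contract Z (contract Y (contract X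
      (ι ℝ (f a) * ι ℝ (f b) * ι ℝ (f c) * ι ℝ (f d))))) =
    minorFour (fun i => f i X) (fun i => f i Y) (fun i => f i Z) (fun i => f i W) a b c d •
      (1 : ExteriorAlgebra ℝ (Dual ℝ V)) := by
  simp only [mul_assoc, contract_ι_mul, contract_ι, map_sub, map_smul,
    Algebra.algebraMap_eq_smul_one, mul_sub, mul_smul_comm, mul_one,
    minorFour, minorTwo]
  module

lemma contract_starPhiForm (X Y Z W : V) (f : Fin 7 → Dual ℝ V) :
    contract W (contract Z (contract Y (contract X (starPhiForm f)))) =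
    starPhiValue (fun i => f i X) (fun i => f i Y) (fun i => f i Z) (fun i => f i W) •
      (1 : ExteriorAlgebra ℝ (Dual ℝ V)) := by
  simp only [starPhiForm, map_add, map_sub, contract_four, starPhiValue]
  module

lemma starPhiForm_mem_degPart {W : Type*} [AddCommGroup W] [Module ℝ W] (f : Fin 7 → W) :
    starPhiForm f ∈ degPart W 4 := by
  have h (a b c d : Fin 7) : ι ℝ (f a) * ι ℝ (f b) * ι ℝ (f c) * ι ℝ (f d) ∈ degPart W 4 :=
    mul_mem_degPart (k := 3) (mul_mem_degPart (k := 2) (mul_mem_degPart (k := 1)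
      (ι_mem_degPart _) (ι_mem_degPart _)) (ι_mem_degPart _)) (ι_mem_degPart _)
  exact add_mem (sub_mem (add_mem (add_mem (add_mem (add_mem (h _ _ _ _) (h _ _ _ _))
    (h _ _ _ _)) (h _ _ _ _)) (h _ _ _ _)) (h _ _ _ _)) (h _ _ _ _)

lemma starPhiValue_crossSeven (x y w : Fin 7 → ℝ) :
    starPhiValue y x (crossSeven x y) w = 0 := by
  simp only [starPhiValue, minorFour, minorTwo, crossSeven, Matrix.cons_val]
  ring

/-- The matrix of the 2-form `∗φ(y, x, ·, ·)` in terms of the minors `m` of `(y, x)`. -/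
def starPhiMatrix (m : Fin 7 → Fin 7 → ℝ) : Fin 7 → Fin 7 → ℝ :=
  ![![0, m 2 3 + m 4 5, -m 1 3 + m 5 6, m 1 2 + m 4 6, -m 1 5 - m 3 6, m 1 4 - m 2 6,
      m 2 5 + m 3 4],
    ![-m 2 3 - m 4 5, 0, m 0 3 + m 4 6, -m 0 2 - m 5 6, m 0 5 - m 2 6, -m 0 4 + m 3 6,
      m 2 4 - m 3 5],
    ![m 1 3 - m 5 6, -m 0 3 - m 4 6, 0, m 0 1 + m 4 5, m 1 6 - m 3 5, m 0 6 + m 3 4,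
      -m 0 5 - m 1 4],
    ![-m 1 2 - m 4 6, m 0 2 + m 5 6, -m 0 1 - m 4 5, 0, m 0 6 + m 2 5, -m 1 6 - m 2 4,
      -m 0 4 + m 1 5],
    ![m 1 5 + m 3 6, -m 0 5 + m 2 6, -m 1 6 + m 3 5, -m 0 6 - m 2 5, 0, m 0 1 + m 2 3,
      m 0 3 + m 1 2],
    ![-m 1 4 + m 2 6, m 0 4 - m 3 6, -m 0 6 - m 3 4, m 1 6 + m 2 4, -m 0 1 - m 2 3, 0,
      m 0 2 - m 1 3],
    ![-m 2 5 - m 3 4, -m 2 4 + m 3 5, m 0 5 + m 1 4, m 0 4 - m 1 5, -m 0 3 - m 1 2,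
      -m 0 2 + m 1 3, 0]]

lemma starPhiValue_single (x y : Fin 7 → ℝ) (v w : Fin 7) :
    starPhiValue y x (Pi.single v 1) (Pi.single w 1) = starPhiMatrix (minorTwo y x) v w := by
  fin_cases v <;> fin_cases w <;>
    simp [starPhiValue, minorFour, starPhiMatrix, minorTwo] <;> ring

/-- The contraction of `∗φ` with two independent vectors has rank four: a 1-form `η` which is
orthogonal to `x`, `y`, `x × y` and satisfies `η ∧ ι_x ι_y ∗φ = 0` vanishes. -/
lemma gram_mul_eq_zero (x y η : Fin 7 → ℝ)
    (hx : ∑ i, x i * η i = 0) (hy : ∑ i, y i * η i = 0) (hN : ∑ i, crossSeven x y i * η i = 0)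
    (h : ∀ u v w, η u * starPhiValue y x (Pi.single v 1) (Pi.single w 1) -
      η v * starPhiValue y x (Pi.single u 1) (Pi.single w 1) +
      η w * starPhiValue y x (Pi.single u 1) (Pi.single v 1) = 0) (u : Fin 7) :
    ((∑ i, x i ^ 2) * (∑ i, y i ^ 2) - (∑ i, x i * y i) ^ 2) * η u = 0 := by
  have h' := Finset.sum_eq_zero fun v (_ : v ∈ Finset.univ) =>
    Finset.sum_eq_zero fun w (_ : w ∈ Finset.univ) =>
      mul_eq_zero_of_right (starPhiValue y x (Pi.single v 1) (Pi.single w 1)) (h u v w)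
  have key : 2 * (((∑ i, x i ^ 2) * (∑ i, y i ^ 2) - (∑ i, x i * y i) ^ 2) * η u) =
      ∑ v, ∑ w, starPhiValue y x (Pi.single v 1) (Pi.single w 1) *
        (η u * starPhiValue y x (Pi.single v 1) (Pi.single w 1) -
          η v * starPhiValue y x (Pi.single u 1) (Pi.single w 1) +
          η w * starPhiValue y x (Pi.single u 1) (Pi.single v 1)) -
      2 * (x u * (∑ i, y i ^ 2) - y u * (∑ i, x i * y i)) * (∑ i, x i * η i) -
      2 * (y u * (∑ i, x i ^ 2) - x u * (∑ i, x i * y i)) * (∑ i, y i * η i) -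
      2 * crossSeven x y u * (∑ i, crossSeven x y i * η i) := by
    clear h' h hx hy hN
    simp only [starPhiValue_single, Fin.sum_univ_seven]
    fin_cases u <;>
      simp only [starPhiMatrix, crossSeven, minorTwo, Fin.reduceFinMk, Fin.zero_eta, Fin.mk_one,
        Fin.isValue, Matrix.cons_val] <;> ring
  rw [h', hx, hy, hN] at key
  linarith

end TwoDimensionalCenter

lemma smul_one_exteriorAlgebra_eq_zero {W : Type*} [AddCommGroup W] [Module ℝ W] {r : ℝ}
    (h : r • (1 : ExteriorAlgebra ℝ W) = 0) : r = 0 := by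
  rwa [← Algebra.algebraMap_eq_smul_one, ExteriorAlgebra.algebraMap_eq_zero_iff] at h

lemma sum_minors_sq (x y : Fin 7 → ℝ)
    (h : (∑ i, x i ^ 2) * (∑ i, y i ^ 2) - (∑ i, x i * y i) ^ 2 = 0) (i j : Fin 7) :
    x i * y j - x j * y i = 0 := by
  have key : ∑ i, ∑ j, (x i * y j - x j * y i) ^ 2 = 0 := by
    have : ∑ i, ∑ j, (x i * y j - x j * y i) ^ 2 =
        2 * ((∑ i, x i ^ 2) * (∑ i, y i ^ 2) - (∑ i, x i * y i) ^ 2) := by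
      simp only [Fin.sum_univ_seven]
      ring
    rw [this, h, mul_zero]
  have h1 := (Finset.sum_eq_zero_iff_of_nonneg fun i _ =>
    Finset.sum_nonneg fun j _ => sq_nonneg _).1 key i (Finset.mem_univ i)
  have h2 := (Finset.sum_eq_zero_iff_of_nonneg fun j _ => sq_nonneg _).1 h1 j (Finset.mem_univ j)
  exact pow_eq_zero_iff (two_ne_zero) |>.1 h2

lemma dot_crossSeven (x y : Fin 7 → ℝ) :
    ∑ i, x i * crossSeven x y i = 0 ∧ ∑ i, y i * crossSeven x y i = 0 ∧
      ∑ i, crossSeven x y i * crossSeven x y i =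
        (∑ i, x i ^ 2) * (∑ i, y i ^ 2) - (∑ i, x i * y i) ^ 2 := by
  simp only [Fin.sum_univ_seven, crossSeven, Matrix.cons_val]
  refine ⟨?_, ?_, ?_⟩ <;> ring

/-- The basis of a space which is dual to a given basis of its dual. -/
lemma exists_predual_basis {V : Type*} [AddCommGroup V] [Module ℝ V] [FiniteDimensional ℝ V]
    {n : ℕ} (f : Basis (Fin n) ℝ (Dual ℝ V)) :
    ∃ F : Basis (Fin n) ℝ V, ∀ i j, f i (F j) = if i = j then 1 else 0 := by
  refine ⟨f.dualBasis.map (Module.evalEquiv ℝ V).symm, fun i j => ?_⟩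
  simp [Finsupp.single_apply]

/-- If two 2-forms `dλ₁, dλ₂` wedge to zero with a 2-form `A`, then contraction with `N`
and evaluation gives a cyclic identity. -/
lemma cyclic_identity {V : Type*} [AddCommGroup V] [Module ℝ V] {η : Dual ℝ V}
    {A : ExteriorAlgebra ℝ (Dual ℝ V)} (h : ι ℝ η * A = 0)
    {a : V → V → ℝ} (ha : ∀ v w, contract w (contract v A) = a v w • 1) (u v w : V) :
    η u * a v w - η v * a u w + η w * a u v = 0 := by
  have := congrArg (contract w) (congrArg (contract v) (congrArg (contract u) h))
  simp only [contract_ι_mul, map_sub, map_smul, ha, map_zero, contract_one, smul_zero,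
    mul_zero, sub_zero] at this
  refine smul_one_exteriorAlgebra_eq_zero (W := Dual ℝ V) ?_
  rw [← this]
  module

/-- A Lie algebra whose center is the two-dimensional commutator ideal admits no coclosed
G₂-structure. -/
lemma not_admitsCoclosedG2 (z₁ z₂ : g) (l₁ l₂ : Dual ℝ g)
    (hind : ∀ s t : ℝ, s • z₁ + t • z₂ = 0 → s = 0 ∧ t = 0)
    (hbr : ∀ x y : g, ⁅x, y⁆ = l₁ ⁅x, y⁆ • z₁ + l₂ ⁅x, y⁆ • z₂)
    (hz₁ : ∀ x : g, ⁅z₁, x⁆ = 0) (hz₂ : ∀ x : g, ⁅z₂, x⁆ = 0)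
    (hcen : ∀ N : g, (∀ x : g, ⁅N, x⁆ = 0) → ∃ s t : ℝ, N = s • z₁ + t • z₂) :
    ¬ AdmitsCoclosedG2 g := by
  rintro ⟨b, d, hd, f, hf⟩
  have : FiniteDimensional ℝ g := b.finiteDimensional_of_finite
  obtain ⟨F, hF⟩ := exists_predual_basis f
  set c : Fin 2 → ExteriorAlgebra ℝ (Dual ℝ g) := ![ceOneForm b l₁, ceOneForm b l₂] with hc
  have hd' : d = wedgeContract c ![z₁, z₂] := by
    refine hd.eq_wedgeContract ?_ ?_
    · intro k x
      fin_cases k <;> exact commute_ceOneForm _ _ _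
    · intro α
      rw [Fin.sum_univ_two]
      simp only [hc, Matrix.cons_val_zero, Matrix.cons_val_one, ← map_smul, ← map_add]
      rw [ceOneForm_apply, ceOneForm_apply]
      congr 1
      refine Finset.sum_congr rfl fun i _ => Finset.sum_congr rfl fun j _ => ?_
      congr 1
      conv_lhs => rw [hbr]
      simp [mul_comm]
  set Φ := starPhiForm fun i => f i with hΦ
  rw [hd', wedgeContract_apply, Fin.sum_univ_two] at hf
  simp only [hc, Matrix.cons_val_zero, Matrix.cons_val_one] at hf
  have hcz (z : g) (hz : ∀ x : g, ⁅z, x⁆ = 0) (l : Dual ℝ g) : contract z (ceOneForm b l) = 0 := by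
    rw [contract_ceOneForm, neg_eq_zero, ExteriorAlgebra.ι_eq_zero_iff]
    ext x
    simp [hz]
  have hcm (z : g) (l : Dual ℝ g) (y) : contract z (ceOneForm b l * y) =
      contract z (ceOneForm b l) * y + ceOneForm b l * contract z y := by
    rw [contract_mul _ (ceOneForm_mem_degPart b l)]
    simp
  have hΦ4 : Φ ∈ degPart (Dual ℝ g) 4 := starPhiForm_mem_degPart _
  set A := contract z₁ (contract z₂ Φ) with hA
  have hA2 : A ∈ degPart (Dual ℝ g) 2 := contract_mem_degPart _ (contract_mem_degPart _ hΦ4)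
  have hself (z : g) (x) : contract z (contract z x) = 0 :=
    CliffordAlgebra.contractLeft_contractLeft _ _
  have h1 : ceOneForm b l₁ * A = 0 := by
    have := congrArg (contract z₂) hf
    simp only [map_add, hcm, hcz z₂ hz₂, hself, zero_mul, zero_add, mul_zero, add_zero,
      map_zero] at this
    rw [hA, contract_comm, mul_neg, this, neg_zero]
  have h2 : ceOneForm b l₂ * A = 0 := by
    have := congrArg (contract z₁) hf
    simpa only [map_add, hcm, hcz z₁ hz₁, hself, zero_mul, zero_add, mul_zero, add_zero,
      map_zero] using this
  set x : Fin 7 → ℝ := fun i => f i z₁ with hx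
  set y : Fin 7 → ℝ := fun i => f i z₂ with hy
  set N : g := ∑ i, crossSeven x y i • F i with hN
  have hfN (i) : f i N = crossSeven x y i := by simp [hN, hF]
  have hexp (v : g) : v = ∑ i, f i v • F i := by
    conv_lhs => rw [← F.sum_repr v]
    refine Finset.sum_congr rfl fun i _ => ?_
    congr 1
    have : f i v = ∑ k, F.repr v k * f i (F k) := by
      conv_lhs => rw [← F.sum_repr v]
      simp only [map_sum, map_smul, smul_eq_mul]
    simp [this, hF]
  have ha (v w : g) : contract w (contract v A) =
      starPhiValue y x (fun i => f i v) (fun i => f i w) • (1 : ExteriorAlgebra ℝ (Dual ℝ g)) :=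
    contract_starPhiForm _ _ _ _ _
  have hNA : contract N A = 0 := by
    have hmem := contract_mem_degPart N (k := 1) hA2
    rw [degPart, pow_one] at hmem
    obtain ⟨ψ, hψ⟩ := hmem
    rw [← hψ, ExteriorAlgebra.ι_eq_zero_iff]
    ext w
    have := ha N w
    simp only [hfN] at this
    rw [starPhiValue_crossSeven, zero_smul, ← hψ, contract_ι, Algebra.algebraMap_eq_smul_one]
      at this
    exact smul_one_exteriorAlgebra_eq_zero this
  have hsingle (j) : (fun i => f i (F j)) = Pi.single j (1 : ℝ) := by
    ext i
    simp [hF, Pi.single_apply]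
  have hzero (l : Dual ℝ g) (hl : ceOneForm b l * A = 0) (u) :
      ((∑ i, x i ^ 2) * (∑ i, y i ^ 2) - (∑ i, x i * y i) ^ 2) * l ⁅N, F u⁆ = 0 := by
    have hl' := congrArg (contract N) hl
    rw [hcm, hNA, mul_zero, add_zero, map_zero, contract_ceOneForm, neg_mul, neg_eq_zero] at hl'
    have hsum (v : g) (hv : ⁅N, v⁆ = 0) : ∑ i, f i v * l ⁅N, F i⁆ = 0 := by
      have : l ⁅N, v⁆ = 0 := by rw [hv, map_zero]
      conv_lhs at this => rw [hexp v]
      rw [lie_sum, map_sum] at this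
      simpa only [lie_smul, map_smul, smul_eq_mul] using this
    refine gram_mul_eq_zero x y (fun u => l ⁅N, F u⁆) (hsum z₁ ?_) (hsum z₂ ?_) ?_ ?_ u
    · rw [← lie_skew, hz₁, neg_zero]
    · rw [← lie_skew, hz₂, neg_zero]
    · simpa only [hfN] using hsum N (lie_self N)
    · intro u v w
      have := cyclic_identity hl' ha (F u) (F v) (F w)
      simp only [hsingle] at this
      exact this
  have hgram : (∑ i, x i ^ 2) * (∑ i, y i ^ 2) - (∑ i, x i * y i) ^ 2 = 0 := by
    by_contra hne
    have hNc : ∀ v : g, ⁅N, v⁆ = 0 := by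
      intro v
      rw [hexp v, lie_sum]
      refine Finset.sum_eq_zero fun i _ => ?_
      rw [lie_smul, hbr, (mul_eq_zero.1 (hzero l₁ h1 i)).resolve_left hne,
        (mul_eq_zero.1 (hzero l₂ h2 i)).resolve_left hne]
      simp
    obtain ⟨s, t, hst⟩ := hcen N hNc
    have hco (i) : crossSeven x y i = s * x i + t * y i := by
      rw [← hfN, hst]
      simp [hx, hy]
    obtain ⟨e1, e2, e3⟩ := dot_crossSeven x y
    apply hne
    rw [← e3]
    calc ∑ i, crossSeven x y i * crossSeven x y i
        = s * ∑ i, x i * crossSeven x y i + t * ∑ i, y i * crossSeven x y i := by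
          rw [Finset.mul_sum, Finset.mul_sum, ← Finset.sum_add_distrib]
          refine Finset.sum_congr rfl fun i _ => ?_
          conv_lhs => rw [hco]
          conv_rhs => rw [hco]
          ring
      _ = 0 := by rw [e1, e2]; ring
  have hm := sum_minors_sq x y hgram
  have hx0 (j) : x j = 0 := by
    have : y j • z₁ + (-x j) • z₂ = 0 := by
      rw [hexp (y j • z₁ + (-x j) • z₂)]
      refine Finset.sum_eq_zero fun i _ => ?_
      have := hm i j
      have e : f i (y j • z₁ + (-x j) • z₂) = 0 := by
        simp only [map_add, map_smul, smul_eq_mul]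
        linear_combination this
      rw [e, zero_smul]
    simpa using (hind _ _ this).2
  have hz0 : z₁ = 0 := by
    rw [hexp z₁]
    exact Finset.sum_eq_zero fun i _ => by rw [show f i z₁ = 0 from hx0 i, zero_smul]
  simpa using (hind 1 0 (by simp [hz0])).1

lemma contract_contract_ι_mul_ι {V : Type*} [AddCommGroup V] [Module ℝ V] (x y : V)
    (α β : Dual ℝ V) : contract y (contract x (ι ℝ α * ι ℝ β)) =
      algebraMap ℝ _ (α x * β y - β x * α y) := by
  rw [contract_ι_mul, contract_ι, map_sub, map_smul, contract_ι, contract_ι_mul,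
    contract_algebraMap, mul_zero, sub_zero, Algebra.smul_def, Algebra.smul_def, ← map_mul,
    ← map_mul, ← map_sub, mul_comm (α y)]

lemma IsCEDifferential.contract_contract {n : ℕ} {b : Basis (Fin n) ℝ g}
    {d : ExteriorAlgebra ℝ (Dual ℝ g) →ₗ[ℝ] ExteriorAlgebra ℝ (Dual ℝ g)}
    (hd : IsCEDifferential b d) (α : Dual ℝ g) (x y : g) :
    contract y (contract x (d (ι ℝ α))) = algebraMap ℝ _ (-α ⁅x, y⁆) := by
  rw [hd.map_ι, contract_ceOneForm, map_neg, contract_ι, map_neg]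
  rfl

section StructureEquations

variable {b : Basis (Fin 7) ℝ g}
  {d : ExteriorAlgebra ℝ (Dual ℝ g) →ₗ[ℝ] ExteriorAlgebra ℝ (Dual ℝ g)}

lemma IsCEDifferential.coord_lie_of_eq_zero (hd : IsCEDifferential b d) {i : Fin 7}
    (h : d (ef b i) = 0) (x y : g) : b.coord i ⁅x, y⁆ = 0 := by
  have := hd.contract_contract (b.dualBasis i) x y
  rw [show d (ι ℝ (b.dualBasis i)) = 0 from h, map_zero, map_zero] at this
  simpa using (algebraMap ℝ (ExteriorAlgebra ℝ (Dual ℝ g))).injective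
    (this.symm.trans (map_zero _).symm)

lemma IsCEDifferential.coord_lie_of_eq_mul (hd : IsCEDifferential b d) {i j k : Fin 7}
    (h : d (ef b i) = ef b j * ef b k) (x y : g) : b.coord i ⁅x, y⁆ =
      -(b.coord j x * b.coord k y - b.coord k x * b.coord j y) := by
  have := hd.contract_contract (b.dualBasis i) x y
  rw [show d (ι ℝ (b.dualBasis i)) = _ from h, ef, ef, contract_contract_ι_mul_ι] at this
  have := (algebraMap ℝ (ExteriorAlgebra ℝ (Dual ℝ g))).injective this
  simp only [Basis.coe_dualBasis] at this
  linarith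

lemma IsCEDifferential.coord_lie_of_eq_mul_add_mul (hd : IsCEDifferential b d)
    {i j k l m : Fin 7} (h : d (ef b i) = ef b j * ef b k + ef b l * ef b m) (x y : g) :
    b.coord i ⁅x, y⁆ = -(b.coord j x * b.coord k y - b.coord k x * b.coord j y +
      (b.coord l x * b.coord m y - b.coord m x * b.coord l y)) := by
  have := hd.contract_contract (b.dualBasis i) x y
  rw [show d (ι ℝ (b.dualBasis i)) = _ from h, ef, ef, ef, ef, map_add, map_add,
    contract_contract_ι_mul_ι, contract_contract_ι_mul_ι, ← map_add] at this
  have := (algebraMap ℝ (ExteriorAlgebra ℝ (Dual ℝ g))).injective this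
  simp only [Basis.coe_dualBasis] at this
  linarith

/-- A Lie algebra whose structure equations have the shape `deⁱ = 0` for `i ≤ 4` admits no
coclosed G₂-structure as soon as its center is spanned by the last two basis vectors. -/
lemma not_admitsCoclosedG2_of_basis (b : Basis (Fin 7) ℝ g)
    (hlow : ∀ i : Fin 7, i ≤ 4 → ∀ x y : g, b.coord i ⁅x, y⁆ = 0)
    (h5 : ∀ x : g, b.coord 5 ⁅b 5, x⁆ = 0 ∧ b.coord 6 ⁅b 5, x⁆ = 0)
    (h6 : ∀ x : g, b.coord 5 ⁅b 6, x⁆ = 0 ∧ b.coord 6 ⁅b 6, x⁆ = 0)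
    (hcen : ∀ N : g, (∀ x : g, ⁅N, x⁆ = 0) → b.coord 0 N = 0 ∧ b.coord 1 N = 0 ∧
      b.coord 2 N = 0 ∧ b.coord 3 N = 0 ∧ b.coord 4 N = 0) :
    ¬ AdmitsCoclosedG2 g := by
  have key (x : g) (hx : b.coord 0 x = 0 ∧ b.coord 1 x = 0 ∧
      b.coord 2 x = 0 ∧ b.coord 3 x = 0 ∧ b.coord 4 x = 0) :
      x = b.coord 5 x • b 5 + b.coord 6 x • b 6 := by
    obtain ⟨h0, h1, h2, h3, h4⟩ := hx
    conv_lhs => rw [← b.sum_repr x]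
    simp only [Fin.sum_univ_seven, ← Basis.coord_apply]
    rw [h0, h1, h2, h3, h4]
    simp only [zero_smul, zero_add]
  have key' (x y : g) := key ⁅x, y⁆ ⟨hlow 0 (by decide) x y, hlow 1 (by decide) x y,
    hlow 2 (by decide) x y, hlow 3 (by decide) x y, hlow 4 (by decide) x y⟩
  refine not_admitsCoclosedG2 (b 5) (b 6) (b.coord 5) (b.coord 6) ?_ key' ?_ ?_
    fun N hN => ⟨_, _, key N (hcen N hN)⟩
  · intro s t h
    have e5 := congrArg (b.coord 5) h
    have e6 := congrArg (b.coord 6) h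
    simp at e5 e6
    exact ⟨e5, e6⟩
  · intro x
    rw [key', (h5 x).1, (h5 x).2, zero_smul, zero_smul, add_zero]
  · intro x
    rw [key', (h6 x).1, (h6 x).2, zero_smul, zero_smul, add_zero]

lemma HasStructure27A.not_admitsCoclosedG2 (h : HasStructure27A g) : ¬ AdmitsCoclosedG2 g := by
  obtain ⟨b, d, hd, hlow, h5, h6⟩ := h
  have e5 := hd.coord_lie_of_eq_mul h5
  have e6 := hd.coord_lie_of_eq_mul_add_mul h6
  refine not_admitsCoclosedG2_of_basis b (fun i hi => hd.coord_lie_of_eq_zero (hlow i hi))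
    (fun x => ?_) (fun x => ?_) (fun N hN => ?_)
  · rw [e5, e6]; simp
  · rw [e5, e6]; simp
  · have n0 := e5 N (b 1)
    have n1 := e5 N (b 0)
    have n2 := e6 N (b 4)
    have n3 := e6 N (b 0)
    have n4 := e6 N (b 2)
    simp only [hN, map_zero] at n0 n1 n2 n3 n4
    simp at n0 n1 n2 n3 n4
    simp only [Basis.coord_apply]
    exact ⟨n0, n1.symm, n2, n3.symm, n4.symm⟩

lemma HasStructure27B.not_admitsCoclosedG2 (h : HasStructure27B g) : ¬ AdmitsCoclosedG2 g := by
  obtain ⟨b, d, hd, hlow, h5, h6⟩ := h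
  have e5 := hd.coord_lie_of_eq_mul_add_mul h5
  have e6 := hd.coord_lie_of_eq_mul_add_mul h6
  refine not_admitsCoclosedG2_of_basis b (fun i hi => hd.coord_lie_of_eq_zero (hlow i hi))
    (fun x => ?_) (fun x => ?_) (fun N hN => ?_)
  · rw [e5, e6]; simp
  · rw [e5, e6]; simp
  · have n0 := e5 N (b 1)
    have n1 := e5 N (b 0)
    have n2 := e5 N (b 3)
    have n3 := e5 N (b 2)
    have n4 := e6 N (b 0)
    simp only [hN, map_zero] at n0 n1 n2 n3 n4
    simp at n0 n1 n2 n3 n4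
    simp only [Basis.coord_apply]
    exact ⟨n0, n1.symm, n2, n3.symm, n4.symm⟩

end StructureEquations

section AnticommutingGenerators

variable {R : Type*} [Ring R] [Algebra ℝ R] {e : Fin 7 → R} {d : R →ₗ[ℝ] R}

lemma coclosed_of_d_six (hsq : ∀ i, e i * e i = 0) (hanti : ∀ i j, e i * e j = -(e j * e i))
    (hd : ∀ i y, d (e i * y) = d (e i) * y - e i * d y) (h0 : ∀ i : Fin 7, i ≤ 5 → d (e i) = 0)
    (h6 : d (e 6) = -(e 0 * e 1 + e 2 * e 3 - 2 • (e 4 * e 5))) :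
    d (e 0 * e 1 * e 2 * e 3 + e 0 * e 1 * e 4 * e 5 + e 0 * e 2 * e 5 * e 6 +
      e 0 * e 3 * e 4 * e 6 + e 1 * e 2 * e 4 * e 6 - e 1 * e 3 * e 5 * e 6 +
      e 2 * e 3 * e 4 * e 5) = 0 := by
  have swap {i j : Fin 7} (_ : i < j) : e j * e i = -(e i * e j) := hanti j i
  have swap' {i j : Fin 7} (_ : i < j) (x : R) : e j * (e i * x) = -(e i * (e j * x)) := by
    rw [← mul_assoc, hanti j i, neg_mul, mul_assoc]
  have sq' (i : Fin 7) (x : R) : e i * (e i * x) = 0 := by rw [← mul_assoc, hsq, zero_mul]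
  simp only [mul_assoc, map_add, map_sub, hd, h0, h6, Fin.reduceLE, zero_mul, mul_zero, sub_zero,
    zero_sub, add_zero, mul_add, mul_sub, mul_neg, neg_neg, mul_smul_comm, swap, swap',
    sq', hsq, Fin.reduceLT, smul_zero, neg_zero, sub_self]
  try abel

lemma phi_mul_d_phi_of_d_six (hsq : ∀ i, e i * e i = 0)
    (hanti : ∀ i j, e i * e j = -(e j * e i))
    (hd : ∀ i y, d (e i * y) = d (e i) * y - e i * d y) (h0 : ∀ i : Fin 7, i ≤ 5 → d (e i) = 0)
    (h6 : d (e 6) = -(e 0 * e 1 + e 2 * e 3 - 2 • (e 4 * e 5))) :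
    (e 0 * e 1 * e 6 + e 2 * e 3 * e 6 + e 4 * e 5 * e 6 + e 0 * e 2 * e 4 -
      e 0 * e 3 * e 5 - e 1 * e 2 * e 5 - e 1 * e 3 * e 4) *
      d (e 0 * e 1 * e 6 + e 2 * e 3 * e 6 + e 4 * e 5 * e 6 + e 0 * e 2 * e 4 -
        e 0 * e 3 * e 5 - e 1 * e 2 * e 5 - e 1 * e 3 * e 4) = 0 := by
  have swap {i j : Fin 7} (_ : i < j) : e j * e i = -(e i * e j) := hanti j i
  have swap' {i j : Fin 7} (_ : i < j) (x : R) : e j * (e i * x) = -(e i * (e j * x)) := by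
    rw [← mul_assoc, hanti j i, neg_mul, mul_assoc]
  have sq' (i : Fin 7) (x : R) : e i * (e i * x) = 0 := by rw [← mul_assoc, hsq, zero_mul]
  have key : d (e 0 * e 1 * e 6 + e 2 * e 3 * e 6 + e 4 * e 5 * e 6 + e 0 * e 2 * e 4 -
        e 0 * e 3 * e 5 - e 1 * e 2 * e 5 - e 1 * e 3 * e 4) =
      -(2 • (e 0 * (e 1 * (e 2 * e 3))) - e 0 * (e 1 * (e 4 * e 5)) -
        e 2 * (e 3 * (e 4 * e 5))) := by
    simp only [mul_assoc, map_add, map_sub, hd, h0, h6, Fin.reduceLE, zero_mul, mul_zero, sub_zero,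
      zero_sub, add_zero, zero_add, mul_add, mul_sub, mul_neg, neg_neg, mul_smul_comm, swap, swap',
      hsq, Fin.reduceLT, smul_zero, neg_zero, sub_self]
    abel
  rw [key]
  simp only [mul_assoc, mul_zero, sub_zero, add_mul, sub_mul, add_zero, zero_add, mul_sub, mul_neg,
    neg_neg, mul_smul_comm, swap, swap', sq', hsq, Fin.reduceLT, neg_zero]
  try abel

end AnticommutingGenerators

section CentralTwoForms

variable {R : Type*} [Ring R] [Algebra ℝ R] {d : R →ₗ[ℝ] R} {t W S : Fin 3 → R} {v : R}

lemma d_starPhi_of_products (hd : ∀ i y, d (t i * y) = W i * y - t i * d y)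
    (hS : ∀ i, d (S i) = 0) (hv : d v = 0) (hW : ∀ i y, W i * y = y * W i)
    (hWS : ∀ i j, i ≠ j → W i * S j = 0) :
    d (t 0 * (t 1 * S 2) - t 0 * (t 2 * S 1) + t 1 * (t 2 * S 0) + v) = 0 := by
  have h (i j k : Fin 3) (hij : i ≠ j) : W i * (t k * S j) = 0 := by
    rw [hW, mul_assoc, ← hW, hWS i j hij, mul_zero]
  simp only [map_add, map_sub, hd, hS, hv, mul_zero, sub_zero]
  rw [h 0 2 1 (by decide), h 0 1 2 (by decide), h 1 0 2 (by decide), hWS 1 2 (by decide),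
    hWS 2 1 (by decide), hWS 2 0 (by decide)]
  simp

lemma phi_mul_d_phi_of_products (hsq : ∀ i, t i * t i = 0)
    (hanti : ∀ i j, t i * t j = -(t j * t i)) (h1 : d 1 = 0)
    (hd : ∀ i y, d (t i * y) = W i * y - t i * d y)
    (hS : ∀ i, d (S i) = 0) (hW : ∀ i y, W i * y = y * W i) (hSc : ∀ i y, S i * y = y * S i)
    (hWS : ∀ i j, i ≠ j → W i * S j = 0) (h00 : W 0 * S 0 = -v) (h11 : W 1 * S 1 = -v)
    (h22 : W 2 * S 2 = 2 • v) :
    (t 0 * (t 1 * t 2) + t 0 * S 0 + t 1 * S 1 + t 2 * S 2) *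
      d (t 0 * (t 1 * t 2) + t 0 * S 0 + t 1 * S 1 + t 2 * S 2) = 0 := by
  have ht (i) : d (t i) = W i := by
    rw [← mul_one (t i), hd, h1, mul_one, mul_zero, sub_zero]
  have key : d (t 0 * (t 1 * t 2) + t 0 * S 0 + t 1 * S 1 + t 2 * S 2) =
      W 0 * (t 1 * t 2) - W 1 * (t 0 * t 2) + W 2 * (t 0 * t 1) := by
    simp only [map_add, hd, hS, ht, h00, h11, h22, hW 2 (t 0 * t 1), hW 1 (t 0 * t 2), mul_sub,
      mul_zero, mul_assoc, ← hW 1 (t 2)]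
    noncomm_ring
  have hp (i j : Fin 3) (u : R) : t i * S i * (W j * u) = W j * S i * (t i * u) := by
    rw [hW j u, ← mul_assoc, ← hW, ← hSc, mul_assoc (S i), ← mul_assoc]
  have hq (j : Fin 3) (u : R) : t 0 * (t 1 * t 2) * (W j * u) = W j * (t 0 * (t 1 * t 2) * u) := by
    rw [hW j u, ← mul_assoc, ← hW]
  have z0 : t 0 * (t 1 * t 2) * (t 1 * t 2) = 0 := by
    rw [mul_assoc, mul_assoc (t 1), ← mul_assoc (t 2) (t 1), hanti 2 1, neg_mul, mul_assoc (t 1),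
      hsq]
    simp
  have z1 : t 0 * (t 1 * t 2) * (t 0 * t 2) = 0 := by
    rw [hanti 0 2]
    simp only [mul_neg, mul_assoc]
    rw [← mul_assoc (t 2), hsq]
    simp
  have z2 : t 0 * (t 1 * t 2) * (t 0 * t 1) = 0 := by
    rw [hanti 1 2, hanti 0 1]
    simp only [mul_neg, mul_assoc, neg_mul]
    rw [← mul_assoc (t 1) (t 1), hsq]
    simp
  have c1 : t 1 * (t 0 * t 2) = -(t 0 * (t 1 * t 2)) := by
    rw [← mul_assoc, hanti 1 0, neg_mul, mul_assoc]
  have c2 : t 2 * (t 0 * t 1) = t 0 * (t 1 * t 2) := by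
    rw [← mul_assoc, hanti 2 0, neg_mul, mul_assoc, hanti 2 1, mul_neg, neg_neg]
  rw [key]
  simp only [add_mul, mul_add, mul_sub, hp, hq, z0, z1, z2, h00, h11, h22, c1, c2,
    hWS 0 1 (by decide), hWS 0 2 (by decide), hWS 1 0 (by decide), hWS 1 2 (by decide),
    hWS 2 0 (by decide), hWS 2 1 (by decide)]
  noncomm_ring

end CentralTwoForms

lemma ef_mul_self (b : Basis (Fin 7) ℝ g) (i : Fin 7) : ef b i * ef b i = 0 :=
  ι_sq_zero _

lemma ef_anticomm (b : Basis (Fin 7) ℝ g) (i j : Fin 7) : ef b i * ef b j = -(ef b j * ef b i) :=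
  eq_neg_of_add_eq_zero_left (ι_add_mul_swap _ _)

/-- The differential of a 1-form on a 7-dimensional Lie algebra, as a sum over pairs `i < j`. -/
lemma ceOneForm_eq_sum_lt (b : Basis (Fin 7) ℝ g) (α : Dual ℝ g) :
    ceOneForm b α = -∑ i, ∑ j ∈ Finset.Ioi i, α ⁅b i, b j⁆ • (ef b i * ef b j) := by
  have hsymm (i j : Fin 7) :
      α ⁅b i, b j⁆ • (ef b i * ef b j) = α ⁅b j, b i⁆ • (ef b j * ef b i) := by
    rw [← lie_skew, map_neg, ef_anticomm, neg_smul_neg]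
  have hsplit (F : Fin 7 → Fin 7 → ExteriorAlgebra ℝ (Dual ℝ g)) (hF : ∀ i j, F i j = F j i)
      (hF' : ∀ i, F i i = 0) : ∑ i, ∑ j, F i j = 2 • ∑ i, ∑ j ∈ Finset.Ioi i, F i j := by
    have h1 (i : Fin 7) : ∑ j, F i j = ∑ j ∈ Finset.Iio i, F i j + ∑ j ∈ Finset.Ioi i, F i j := by
      rw [← Finset.sum_filter_add_sum_filter_not Finset.univ (· < i)]
      congr 1
      · refine Finset.sum_congr ?_ fun _ _ => rfl
        ext; simp
      · rw [show Finset.filter (fun j => ¬ j < i) Finset.univ = insert i (Finset.Ioi i) by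
          ext j; simp [le_iff_eq_or_lt], Finset.sum_insert (by simp), hF', zero_add]
    rw [Finset.sum_congr rfl fun i _ => h1 i, Finset.sum_add_distrib, two_smul]
    congr 1
    rw [Finset.sum_comm' (t' := Finset.univ) (s' := Finset.Ioi) (by simp)]
    exact Finset.sum_congr rfl fun i _ => Finset.sum_congr rfl fun j _ => hF _ _
  rw [ceOneForm_apply]
  change -(2⁻¹ : ℝ) • ∑ i, ∑ j, α ⁅b i, b j⁆ • (ef b i * ef b j) = _
  rw [hsplit _ hsymm fun i => by rw [lie_self, map_zero, zero_smul]]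
  module

lemma ceOneForm_fin_seven (b : Basis (Fin 7) ℝ g) (α : Dual ℝ g) :
    ceOneForm b α = -(
      α ⁅b 0, b 1⁆ • (ef b 0 * ef b 1) + α ⁅b 0, b 2⁆ • (ef b 0 * ef b 2) +
      α ⁅b 0, b 3⁆ • (ef b 0 * ef b 3) + α ⁅b 0, b 4⁆ • (ef b 0 * ef b 4) +
      α ⁅b 0, b 5⁆ • (ef b 0 * ef b 5) + α ⁅b 0, b 6⁆ • (ef b 0 * ef b 6) +
      α ⁅b 1, b 2⁆ • (ef b 1 * ef b 2) + α ⁅b 1, b 3⁆ • (ef b 1 * ef b 3) +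
      α ⁅b 1, b 4⁆ • (ef b 1 * ef b 4) + α ⁅b 1, b 5⁆ • (ef b 1 * ef b 5) +
      α ⁅b 1, b 6⁆ • (ef b 1 * ef b 6) + α ⁅b 2, b 3⁆ • (ef b 2 * ef b 3) +
      α ⁅b 2, b 4⁆ • (ef b 2 * ef b 4) + α ⁅b 2, b 5⁆ • (ef b 2 * ef b 5) +
      α ⁅b 2, b 6⁆ • (ef b 2 * ef b 6) + α ⁅b 3, b 4⁆ • (ef b 3 * ef b 4) +
      α ⁅b 3, b 5⁆ • (ef b 3 * ef b 5) + α ⁅b 3, b 6⁆ • (ef b 3 * ef b 6) +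
      α ⁅b 4, b 5⁆ • (ef b 4 * ef b 5) + α ⁅b 4, b 6⁆ • (ef b 4 * ef b 6) +
      α ⁅b 5, b 6⁆ • (ef b 5 * ef b 6)) := by
  rw [ceOneForm_eq_sum_lt]
  simp only [Fin.sum_univ_seven]
  rw [show Finset.Ioi (0 : Fin 7) = {1, 2, 3, 4, 5, 6} from rfl,
    show Finset.Ioi (1 : Fin 7) = {2, 3, 4, 5, 6} from rfl,
    show Finset.Ioi (2 : Fin 7) = {3, 4, 5, 6} from rfl,
    show Finset.Ioi (3 : Fin 7) = {4, 5, 6} from rfl,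
    show Finset.Ioi (4 : Fin 7) = {5, 6} from rfl,
    show Finset.Ioi (5 : Fin 7) = {6} from rfl,
    show Finset.Ioi (6 : Fin 7) = ∅ from rfl]
  simp only [Finset.sum_insert, Finset.mem_insert, Finset.mem_singleton, Fin.reduceEq, or_self,
    not_false_eq_true, Finset.sum_singleton, Finset.sum_empty]
  abel

lemma starPhiForm_dualBasis (b : Basis (Fin 7) ℝ g) : starPhiForm (fun i => b.dualBasis i) =
    ef b 0 * ef b 1 * ef b 2 * ef b 3 + ef b 0 * ef b 1 * ef b 4 * ef b 5 +
      ef b 0 * ef b 2 * ef b 5 * ef b 6 + ef b 0 * ef b 3 * ef b 4 * ef b 6 +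
      ef b 1 * ef b 2 * ef b 4 * ef b 6 - ef b 1 * ef b 3 * ef b 5 * ef b 6 +
      ef b 2 * ef b 3 * ef b 4 * ef b 5 := by
  simp only [starPhiForm, ef]

lemma phiG2Form_dualBasis (b : Basis (Fin 7) ℝ g) : phiG2Form (fun i => b.dualBasis i) =
    ef b 0 * ef b 1 * ef b 6 + ef b 2 * ef b 3 * ef b 6 + ef b 4 * ef b 5 * ef b 6 +
      ef b 0 * ef b 2 * ef b 4 - ef b 0 * ef b 3 * ef b 5 - ef b 1 * ef b 2 * ef b 5 -
      ef b 1 * ef b 3 * ef b 4 := by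
  simp only [phiG2Form, ef]

/-- A Lie algebra with one-dimensional commutator ideal spanned by a vector dual to a
nondegenerate 2-form on a complement is purely coclosed. -/
lemma admitsPurelyCoclosedG2_of_symplectic (b : Basis (Fin 7) ℝ g)
    (h01 : ⁅b 0, b 1⁆ = b 6) (h02 : ⁅b 0, b 2⁆ = 0) (h03 : ⁅b 0, b 3⁆ = 0)
    (h04 : ⁅b 0, b 4⁆ = 0) (h05 : ⁅b 0, b 5⁆ = 0) (h12 : ⁅b 1, b 2⁆ = 0) (h13 : ⁅b 1, b 3⁆ = 0)
    (h14 : ⁅b 1, b 4⁆ = 0) (h15 : ⁅b 1, b 5⁆ = 0) (h23 : ⁅b 2, b 3⁆ = b 6) (h24 : ⁅b 2, b 4⁆ = 0)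
    (h25 : ⁅b 2, b 5⁆ = 0) (h34 : ⁅b 3, b 4⁆ = 0) (h35 : ⁅b 3, b 5⁆ = 0)
    (h45 : ⁅b 4, b 5⁆ = (-2 : ℝ) • b 6) (h6 : ∀ x : g, ⁅x, b 6⁆ = 0) :
    AdmitsPurelyCoclosedG2 g := by
  have hd := isCEDifferential_ceDifferential b
  have hα (α : Dual ℝ g) : ceDifferential b (ι ℝ α) =
      α (b 6) • -(ef b 0 * ef b 1 + ef b 2 * ef b 3 - 2 • (ef b 4 * ef b 5)) := by
    rw [ceDifferential_ι, ceOneForm_fin_seven]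
    simp only [h01, h02, h03, h04, h05, h12, h13, h14, h15, h23, h24, h25, h34, h35, h45, h6,
      map_zero, zero_smul, add_zero, map_smul, smul_eq_mul]
    module
  have hlow (i : Fin 7) (hi : i ≤ 5) : ceDifferential b (ef b i) = 0 := by
    rw [ef, hα, Basis.coe_dualBasis, Basis.coord_apply, Basis.repr_self,
      Finsupp.single_eq_of_ne (by omega), zero_smul]
  have hsix : ceDifferential b (ef b 6) =
      -(ef b 0 * ef b 1 + ef b 2 * ef b 3 - 2 • (ef b 4 * ef b 5)) := by
    rw [ef, hα, Basis.coe_dualBasis, Basis.coord_apply, Basis.repr_self,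
      Finsupp.single_eq_same, one_smul]
  refine ⟨b, _, hd, b.dualBasis, ?_, ?_⟩
  · rw [starPhiForm_dualBasis]
    exact coclosed_of_d_six (ef_mul_self b) (ef_anticomm b) (fun i => hd.map_ι_mul _) hlow hsix
  · rw [phiG2Form_dualBasis]
    exact phi_mul_d_phi_of_d_six (ef_mul_self b) (ef_anticomm b) (fun i => hd.map_ι_mul _) hlow
      hsix

section SelfDual

variable {R : Type*} [Ring R] {e : Fin 7 → R}

/-- The wedge products of a 2-form with the three self-dual 2-forms in four variables. -/
lemma twoForm_mul_selfDual [Algebra ℝ R] (hsq : ∀ i, e i * e i = 0)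
    (hanti : ∀ i j, e i * e j = -(e j * e i)) (p q r s t u : ℝ) (W : R)
    (hW : W = -(p • (e 2 * e 3) + q • (e 2 * e 4) + r • (e 2 * e 5) +
      s • (e 3 * e 4) + t • (e 3 * e 5) + u • (e 4 * e 5))) :
    W * (e 2 * e 4 - e 3 * e 5) = (t - q) • (e 2 * e 3 * e 4 * e 5) ∧
      W * -(e 2 * e 5 + e 3 * e 4) = (r + s) • (e 2 * e 3 * e 4 * e 5) ∧
      W * (e 2 * e 3 + e 4 * e 5) = -(p + u) • (e 2 * e 3 * e 4 * e 5) := by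
  subst hW
  have swap {i j : Fin 7} (_ : i < j) : e j * e i = -(e i * e j) := hanti j i
  have swap' {i j : Fin 7} (_ : i < j) (x : R) : e j * (e i * x) = -(e i * (e j * x)) := by
    rw [← mul_assoc, hanti j i, neg_mul, mul_assoc]
  have sq' (i : Fin 7) (x : R) : e i * (e i * x) = 0 := by rw [← mul_assoc, hsq, zero_mul]
  refine ⟨?_, ?_, ?_⟩ <;>
  · simp only [mul_assoc, mul_zero, add_mul, mul_add, mul_sub, mul_neg, neg_mul, neg_neg,
      smul_mul_assoc, swap, swap', sq', hsq, Fin.reduceLT, neg_zero, smul_zero, smul_neg, add_zero,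
      zero_add]
    module

lemma starPhi_eq_selfDual (hanti : ∀ i j, e i * e j = -(e j * e i)) :
    e 0 * e 1 * e 2 * e 3 + e 0 * e 1 * e 4 * e 5 + e 0 * e 2 * e 5 * e 6 +
      e 0 * e 3 * e 4 * e 6 + e 1 * e 2 * e 4 * e 6 - e 1 * e 3 * e 5 * e 6 +
      e 2 * e 3 * e 4 * e 5 =
    e 0 * (e 1 * (e 2 * e 3 + e 4 * e 5)) - e 0 * (e 6 * -(e 2 * e 5 + e 3 * e 4)) +
      e 1 * (e 6 * (e 2 * e 4 - e 3 * e 5)) + e 2 * e 3 * e 4 * e 5 := by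
  have swap {i j : Fin 7} (_ : i < j) : e j * e i = -(e i * e j) := hanti j i
  have swap' {i j : Fin 7} (_ : i < j) (x : R) : e j * (e i * x) = -(e i * (e j * x)) := by
    rw [← mul_assoc, hanti j i, neg_mul, mul_assoc]
  simp only [mul_assoc, mul_add, mul_sub, mul_neg, neg_neg, swap, swap', Fin.reduceLT]
  abel

lemma phi_eq_selfDual (hanti : ∀ i j, e i * e j = -(e j * e i)) :
    e 0 * e 1 * e 6 + e 2 * e 3 * e 6 + e 4 * e 5 * e 6 + e 0 * e 2 * e 4 -
      e 0 * e 3 * e 5 - e 1 * e 2 * e 5 - e 1 * e 3 * e 4 =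
    e 0 * (e 1 * e 6) + e 0 * (e 2 * e 4 - e 3 * e 5) + e 1 * -(e 2 * e 5 + e 3 * e 4) +
      e 6 * (e 2 * e 3 + e 4 * e 5) := by
  have swap {i j : Fin 7} (_ : i < j) : e j * e i = -(e i * e j) := hanti j i
  have swap' {i j : Fin 7} (_ : i < j) (x : R) : e j * (e i * x) = -(e i * (e j * x)) := by
    rw [← mul_assoc, hanti j i, neg_mul, mul_assoc]
  simp only [mul_assoc, mul_add, mul_sub, mul_neg, neg_neg, swap, swap', Fin.reduceLT]
  abel

end SelfDual

/-- A Lie algebra with three-dimensional center admits a purely coclosed G₂-structure if the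
self-dual combinations of the brackets on a complement span the center. -/
lemma admitsPurelyCoclosedG2_of_selfDual (b : Basis (Fin 7) ℝ g)
    (hbr : ∀ i : Fin 7, i ≠ 0 → i ≠ 1 → i ≠ 6 → ∀ x y : g, b.coord i ⁅x, y⁆ = 0)
    (hz : ∀ x : g, ⁅x, b 0⁆ = 0 ∧ ⁅x, b 1⁆ = 0 ∧ ⁅x, b 6⁆ = 0)
    (h0 : ⁅b 2, b 4⁆ + ⁅b 5, b 3⁆ = b 0) (h1 : ⁅b 2, b 5⁆ + ⁅b 3, b 4⁆ = -b 1)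
    (h6 : ⁅b 2, b 3⁆ + ⁅b 4, b 5⁆ = (-2 : ℝ) • b 6) : AdmitsPurelyCoclosedG2 g := by
  have hd := isCEDifferential_ceDifferential b
  have hz0 (x : g) : ⁅b 0, x⁆ = 0 := by rw [← lie_skew, (hz x).1, neg_zero]
  have hz1 (x : g) : ⁅b 1, x⁆ = 0 := by rw [← lie_skew, (hz x).2.1, neg_zero]
  have hα (α : Dual ℝ g) : ceDifferential b (ι ℝ α) =
      -(α ⁅b 2, b 3⁆ • (ef b 2 * ef b 3) + α ⁅b 2, b 4⁆ • (ef b 2 * ef b 4) +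
        α ⁅b 2, b 5⁆ • (ef b 2 * ef b 5) + α ⁅b 3, b 4⁆ • (ef b 3 * ef b 4) +
        α ⁅b 3, b 5⁆ • (ef b 3 * ef b 5) + α ⁅b 4, b 5⁆ • (ef b 4 * ef b 5)) := by
    rw [ceDifferential_ι, ceOneForm_fin_seven]
    simp only [hz0, hz1, (hz _).2.2, map_zero, zero_smul, add_zero, zero_add]
  have hlow (i : Fin 7) (hi0 : i ≠ 0) (hi1 : i ≠ 1) (hi6 : i ≠ 6) :
      ceDifferential b (ef b i) = 0 := by
    have := hbr i hi0 hi1 hi6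
    rw [ef, hα]
    simp only [Basis.coe_dualBasis, this, zero_smul, add_zero, neg_zero]
  have hlow2 (i j : Fin 7) (hi0 : i ≠ 0) (hi1 : i ≠ 1) (hi6 : i ≠ 6) (hj0 : j ≠ 0) (hj1 : j ≠ 1)
      (hj6 : j ≠ 6) : ceDifferential b (ef b i * ef b j) = 0 := by
    rw [ef, hd.map_ι_mul]
    change ceDifferential b (ef b i) * _ - _ * ceDifferential b (ef b j) = 0
    rw [hlow i hi0 hi1 hi6, hlow j hj0 hj1 hj6, zero_mul, mul_zero, sub_zero]
  have prod (α : Dual ℝ g) := twoForm_mul_selfDual (ef_mul_self b) (ef_anticomm b) _ _ _ _ _ _ _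
    (hα α)
  set v := ef b 2 * ef b 3 * ef b 4 * ef b 5 with hv
  have p0 (α : Dual ℝ g) : ceDifferential b (ι ℝ α) * (ef b 2 * ef b 4 - ef b 3 * ef b 5) =
      -α (b 0) • v := by
    rw [(prod α).1, ← h0, map_add, ← lie_skew (b 3), map_neg]
    module
  have p1 (α : Dual ℝ g) : ceDifferential b (ι ℝ α) * -(ef b 2 * ef b 5 + ef b 3 * ef b 4) =
      -α (b 1) • v := by
    rw [(prod α).2.1, ← map_neg, ← h1, map_add]
  have p2 (α : Dual ℝ g) : ceDifferential b (ι ℝ α) * (ef b 2 * ef b 3 + ef b 4 * ef b 5) =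
      (2 * α (b 6)) • v := by
    rw [(prod α).2.2, ← map_add, h6, map_smul, smul_eq_mul]
    module
  set t : Fin 3 → ExteriorAlgebra ℝ (Dual ℝ g) := ![ef b 0, ef b 1, ef b 6] with ht
  set W : Fin 3 → ExteriorAlgebra ℝ (Dual ℝ g) := ![ceDifferential b (ef b 0),
    ceDifferential b (ef b 1), ceDifferential b (ef b 6)] with hW
  set S : Fin 3 → ExteriorAlgebra ℝ (Dual ℝ g) := ![ef b 2 * ef b 4 - ef b 3 * ef b 5,
    -(ef b 2 * ef b 5 + ef b 3 * ef b 4), ef b 2 * ef b 3 + ef b 4 * ef b 5] with hS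
  have tW (i y) : ceDifferential b (t i * y) = W i * y - t i * ceDifferential b y := by
    fin_cases i <;> exact hd.map_ι_mul _ _
  have dS (i) : ceDifferential b (S i) = 0 := by
    fin_cases i
    · change ceDifferential b (ef b 2 * ef b 4 - ef b 3 * ef b 5) = 0
      rw [map_sub, hlow2 2 4, hlow2 3 5, sub_zero] <;> decide
    · change ceDifferential b (-(ef b 2 * ef b 5 + ef b 3 * ef b 4)) = 0
      rw [map_neg, map_add, hlow2 2 5, hlow2 3 4, add_zero, neg_zero] <;> decide
    · change ceDifferential b (ef b 2 * ef b 3 + ef b 4 * ef b 5) = 0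
      rw [map_add, hlow2 2 3, hlow2 4 5, add_zero] <;> decide
  have dv : ceDifferential b v = 0 := by
    rw [hv, mul_assoc, mul_assoc, ef, hd.map_ι_mul, ef, hd.map_ι_mul, hlow2 4 5]
    · change ceDifferential b (ef b 2) * _ - _ * (ceDifferential b (ef b 3) * _ - _) = _
      rw [hlow 2, hlow 3]
      · simp
      all_goals decide
    all_goals decide
  have cW (i y) : W i * y = y * W i := by
    fin_cases i <;>
    · change ceDifferential b (ι ℝ _) * y = y * ceDifferential b (ι ℝ _)
      rw [ceDifferential_ι]
      exact commute_ceOneForm b _ y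
  have cE (i j y) : Commute (ef b i * ef b j) y := commute_ι_mul_ι _ _ y
  have cS (i y) : S i * y = y * S i := by
    fin_cases i
    · exact (cE 2 4 y).sub_left (cE 3 5 y)
    · exact ((cE 2 5 y).add_left (cE 3 4 y)).neg_left
    · exact (cE 2 3 y).add_left (cE 4 5 y)
  have co (i j : Fin 7) : b.dualBasis i (b j) = if j = i then 1 else 0 := by
    rw [Basis.coe_dualBasis, Basis.coord_apply, Basis.repr_self, Finsupp.single_apply]
  have WS (i j : Fin 3) (hij : i ≠ j) : W i * S j = 0 := by
    have s0 (k : Fin 7) (hk : k ≠ 0) :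
        ceDifferential b (ef b k) * (ef b 2 * ef b 4 - ef b 3 * ef b 5) = 0 := by
      rw [ef, p0, co, if_neg hk.symm, neg_zero, zero_smul]
    have s1 (k : Fin 7) (hk : k ≠ 1) :
        ceDifferential b (ef b k) * -(ef b 2 * ef b 5 + ef b 3 * ef b 4) = 0 := by
      rw [ef, p1, co, if_neg hk.symm, neg_zero, zero_smul]
    have s2 (k : Fin 7) (hk : k ≠ 6) :
        ceDifferential b (ef b k) * (ef b 2 * ef b 3 + ef b 4 * ef b 5) = 0 := by
      rw [ef, p2, co, if_neg hk.symm, mul_zero, zero_smul]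
    fin_cases i <;> fin_cases j
    · exact absurd rfl hij
    · exact s1 0 (by decide)
    · exact s2 0 (by decide)
    · exact s0 1 (by decide)
    · exact absurd rfl hij
    · exact s2 1 (by decide)
    · exact s0 6 (by decide)
    · exact s1 6 (by decide)
    · exact absurd rfl hij
  have W0 : W 0 * S 0 = -v := by
    refine (p0 _).trans ?_
    rw [co, if_pos rfl, neg_one_smul]
  have W1 : W 1 * S 1 = -v := by
    refine (p1 _).trans ?_
    rw [co, if_pos rfl, neg_one_smul]
  have W2 : W 2 * S 2 = 2 • v := by
    refine (p2 _).trans ?_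
    rw [co, if_pos rfl]
    module
  have tsq (i) : t i * t i = 0 := by fin_cases i <;> exact ef_mul_self b _
  have tanti (i j) : t i * t j = -(t j * t i) := by
    fin_cases i <;> fin_cases j <;> exact ef_anticomm b _ _
  have t0 : t 0 = ef b 0 := rfl
  have t1 : t 1 = ef b 1 := rfl
  have t2 : t 2 = ef b 6 := rfl
  have S0 : S 0 = ef b 2 * ef b 4 - ef b 3 * ef b 5 := rfl
  have S1 : S 1 = -(ef b 2 * ef b 5 + ef b 3 * ef b 4) := rfl
  have S2 : S 2 = ef b 2 * ef b 3 + ef b 4 * ef b 5 := rfl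
  clear_value t W S
  refine ⟨b, _, hd, b.dualBasis, ?_, ?_⟩
  · have key := d_starPhi_of_products tW dS dv cW WS
    rw [t0, t1, t2, S0, S1, S2] at key
    rw [starPhiForm_dualBasis, starPhi_eq_selfDual (ef_anticomm b), key]
  · have key := phi_mul_d_phi_of_products tsq tanti hd.map_one tW dS cW cS WS W0 W1 W2
    rw [t0, t1, t2, S0, S1, S2] at key
    rw [phiG2Form_dualBasis, phi_eq_selfDual (ef_anticomm b), key]

lemma hasStructure27A_of_basis (b : Basis (Fin 7) ℝ g)
    (h01 : ⁅b 0, b 1⁆ = -b 5) (h02 : ⁅b 0, b 2⁆ = 0) (h03 : ⁅b 0, b 3⁆ = -b 6)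
    (h04 : ⁅b 0, b 4⁆ = 0) (h12 : ⁅b 1, b 2⁆ = 0) (h13 : ⁅b 1, b 3⁆ = 0)
    (h14 : ⁅b 1, b 4⁆ = 0) (h23 : ⁅b 2, b 3⁆ = 0) (h24 : ⁅b 2, b 4⁆ = -b 6)
    (h34 : ⁅b 3, b 4⁆ = 0) (h5 : ∀ x : g, ⁅x, b 5⁆ = 0) (h6 : ∀ x : g, ⁅x, b 6⁆ = 0) :
    HasStructure27A g := by
  have hα (α : Dual ℝ g) : ceDifferential b (ι ℝ α) =
      α (b 5) • (ef b 0 * ef b 1) + α (b 6) • (ef b 0 * ef b 3 + ef b 2 * ef b 4) := by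
    rw [ceDifferential_ι, ceOneForm_fin_seven]
    simp only [h01, h02, h03, h04, h12, h13, h14, h23, h24, h34, h5, h6,
      map_zero, map_neg, zero_smul, add_zero]
    module
  refine ⟨b, _, isCEDifferential_ceDifferential b, fun i hi => ?_, ?_, ?_⟩
  · rw [ef, hα, Basis.coe_dualBasis, Basis.coord_apply, Basis.coord_apply, Basis.repr_self,
      Basis.repr_self, Finsupp.single_eq_of_ne (by omega), Finsupp.single_eq_of_ne (by omega),
      zero_smul, zero_smul, add_zero]
  · rw [ef, hα, Basis.coe_dualBasis, Basis.coord_apply, Basis.coord_apply, Basis.repr_self,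
      Basis.repr_self, Finsupp.single_eq_same, Finsupp.single_eq_of_ne (by decide),
      zero_smul, one_smul, add_zero]
  · rw [ef, hα, Basis.coe_dualBasis, Basis.coord_apply, Basis.coord_apply, Basis.repr_self,
      Basis.repr_self, Finsupp.single_eq_same, Finsupp.single_eq_of_ne (by decide),
      zero_smul, one_smul, zero_add]

lemma hasStructure27B_of_basis (b : Basis (Fin 7) ℝ g)
    (h01 : ⁅b 0, b 1⁆ = -b 5) (h02 : ⁅b 0, b 2⁆ = 0) (h03 : ⁅b 0, b 3⁆ = 0)
    (h04 : ⁅b 0, b 4⁆ = -b 6) (h12 : ⁅b 1, b 2⁆ = -b 6) (h13 : ⁅b 1, b 3⁆ = 0)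
    (h14 : ⁅b 1, b 4⁆ = 0) (h23 : ⁅b 2, b 3⁆ = -b 5) (h24 : ⁅b 2, b 4⁆ = 0)
    (h34 : ⁅b 3, b 4⁆ = 0) (h5 : ∀ x : g, ⁅x, b 5⁆ = 0) (h6 : ∀ x : g, ⁅x, b 6⁆ = 0) :
    HasStructure27B g := by
  have hα (α : Dual ℝ g) : ceDifferential b (ι ℝ α) =
      α (b 5) • (ef b 0 * ef b 1 + ef b 2 * ef b 3) +
        α (b 6) • (ef b 0 * ef b 4 + ef b 1 * ef b 2) := by
    rw [ceDifferential_ι, ceOneForm_fin_seven]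
    simp only [h01, h02, h03, h04, h12, h13, h14, h23, h24, h34, h5, h6,
      map_zero, map_neg, zero_smul, add_zero]
    module
  refine ⟨b, _, isCEDifferential_ceDifferential b, fun i hi => ?_, ?_, ?_⟩
  · rw [ef, hα, Basis.coe_dualBasis, Basis.coord_apply, Basis.coord_apply, Basis.repr_self,
      Basis.repr_self, Finsupp.single_eq_of_ne (by omega), Finsupp.single_eq_of_ne (by omega),
      zero_smul, zero_smul, add_zero]
  · rw [ef, hα, Basis.coe_dualBasis, Basis.coord_apply, Basis.coord_apply, Basis.repr_self,
      Basis.repr_self, Finsupp.single_eq_same, Finsupp.single_eq_of_ne (by decide),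
      zero_smul, one_smul, add_zero]
  · rw [ef, hα, Basis.coe_dualBasis, Basis.coord_apply, Basis.coord_apply, Basis.repr_self,
      Basis.repr_self, Finsupp.single_eq_same, Finsupp.single_eq_of_ne (by decide),
      zero_smul, one_smul, zero_add]

section Generation

/-- The vectors in the list `l`, together with `Z`, span the whole space. -/
def GeneratesOver {V : Type*} [AddCommGroup V] [Module ℝ V] (Z : Submodule ℝ V) (l : List V) :
    Prop :=
  ∀ S : Submodule ℝ V, Z ≤ S → (∀ x ∈ l, x ∈ S) → S = ⊤

variable {V : Type*} [AddCommGroup V] [Module ℝ V] [FiniteDimensional ℝ V]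

lemma exists_generatesOver (n : ℕ) (Z : Submodule ℝ V)
    (h : finrank ℝ V ≤ finrank ℝ Z + n) : ∃ l : List V, l.length = n ∧ GeneratesOver Z l := by
  induction n generalizing Z with
  | zero =>
    refine ⟨[], rfl, fun S hS _ => top_le_iff.1 (le_trans (le_of_eq ?_) hS)⟩
    exact (Submodule.eq_top_of_finrank_eq (le_antisymm (Submodule.finrank_le _) h)).symm
  | succ n ih =>
    by_cases hZ : Z = ⊤
    · refine ⟨List.replicate (n + 1) 0, by simp, fun S hS _ => top_le_iff.1 (hZ ▸ hS)⟩
    · obtain ⟨x, -, hx⟩ := SetLike.exists_of_lt (lt_top_iff_ne_top.2 hZ)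
      have hlt : Z < Z ⊔ ℝ ∙ x := by
        refine lt_of_le_of_ne le_sup_left fun he => hx ?_
        rw [he]
        exact Submodule.mem_sup_right (Submodule.mem_span_singleton_self x)
      have := Submodule.finrank_lt_finrank_of_lt hlt
      obtain ⟨l, hl, hgen⟩ := ih (Z ⊔ ℝ ∙ x) (by omega)
      refine ⟨x :: l, by simp [hl], fun S hS hS' => hgen S (sup_le hS ?_) fun y hy =>
        hS' y (List.mem_cons_of_mem _ hy)⟩
      rw [Submodule.span_singleton_le_iff_mem]
      exact hS' x List.mem_cons_self

lemma GeneratesOver.finrank_le {Z : Submodule ℝ V} {l : List V} (h : GeneratesOver Z l) :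
    finrank ℝ V ≤ finrank ℝ Z + l.length := by
  classical
  have htop := h (Z ⊔ Submodule.span ℝ (l.toFinset : Set V)) le_sup_left fun x hx =>
    Submodule.mem_sup_right (Submodule.subset_span (by simpa using hx))
  have h1 := Submodule.finrank_add_le_finrank_add_finrank Z
    (Submodule.span ℝ (l.toFinset : Set V))
  rw [htop, finrank_top] at h1
  have h2 : finrank ℝ (Submodule.span ℝ (l.toFinset : Set V)) ≤ l.toFinset.card :=
    finrank_span_finset_le_card _
  have h3 := l.toFinset_card_le
  omega

end Generation

section Brackets

variable {Z : Submodule ℝ g} {l : List g}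

lemma GeneratesOver.lie_eq_zero (h : GeneratesOver Z l) (hZc : ∀ z ∈ Z, ∀ x : g, ⁅x, z⁆ = 0)
    {n : g} (hn : ∀ x ∈ l, ⁅n, x⁆ = 0) (x : g) : ⁅n, x⁆ = 0 := by
  have := h (LinearMap.ker (LieAlgebra.ad ℝ g n : g →ₗ[ℝ] g)) (fun z hz => hZc z hz n) hn
  exact (this ▸ Submodule.mem_top : x ∈ LinearMap.ker (LieAlgebra.ad ℝ g n : g →ₗ[ℝ] g))

/-- The brackets of generators span all brackets. -/
lemma GeneratesOver.lie_mem (h : GeneratesOver Z l) (hZc : ∀ z ∈ Z, ∀ x : g, ⁅x, z⁆ = 0)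
    {S : Submodule ℝ g} (hl : l.Pairwise fun x y => ⁅x, y⁆ ∈ S) (x y : g) : ⁅x, y⁆ ∈ S := by
  have hsymm : Std.Symm fun x y : g => ⁅x, y⁆ ∈ S :=
    ⟨fun x y hxy => by rw [← lie_skew]; exact S.neg_mem hxy⟩
  have hall : ∀ x ∈ l, ∀ y ∈ l, ⁅x, y⁆ ∈ S := fun x hx y hy =>
    hl.forall_of_forall (fun x _ => by rw [lie_self]; exact S.zero_mem) hx hy
  have h1 (x : g) (hx : ∀ y ∈ l, ⁅x, y⁆ ∈ S) (y : g) : ⁅x, y⁆ ∈ S := by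
    have := h (S.comap (LieAlgebra.ad ℝ g x : g →ₗ[ℝ] g))
      (fun z hz => by simp [hZc z hz x]) hx
    exact (this ▸ Submodule.mem_top : y ∈ S.comap (LieAlgebra.ad ℝ g x : g →ₗ[ℝ] g))
  refine h1 x (fun y hy => ?_) y
  rw [← lie_skew]
  exact S.neg_mem (h1 y (hall y hy) x)

lemma exists_basis_of_spans (hdim : finrank ℝ g = 7) (v : Fin 7 → g)
    (h : ∀ S : Submodule ℝ g, (∀ i, v i ∈ S) → S = ⊤) : ∃ b : Basis (Fin 7) ℝ g, ∀ i, b i = v i :=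
  ⟨basisOfTopLeSpanOfCardEqFinrank v
    (h (Submodule.span ℝ (Set.range v)) fun i =>
      Submodule.subset_span (Set.mem_range_self i)).ge (by simp [hdim]), fun i => by simp⟩

end Brackets

section Reduced

/-- `Z` is both the derived algebra and the centre of `g`. -/
structure IsDerivedCenter (Z : Submodule ℝ g) : Prop where
  lie_mem : ∀ x y : g, ⁅x, y⁆ ∈ Z
  lie_eq_zero : ∀ z ∈ Z, ∀ x : g, ⁅x, z⁆ = 0
  mem_of_central : ∀ n : g, (∀ x : g, ⁅n, x⁆ = 0) → n ∈ Z
  le_of_lie_mem : ∀ S : Submodule ℝ g, (∀ x y : g, ⁅x, y⁆ ∈ S) → Z ≤ S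

variable {Z : Submodule ℝ g}

lemma exists_dual_apply_eq_one {V : Type*} [AddCommGroup V] [Module ℝ V] {z : V} (hz : z ≠ 0) :
    ∃ l : Dual ℝ V, l z = 1 := by
  obtain ⟨f, hf⟩ : ∃ f : Dual ℝ V, f z ≠ 0 := by
    by_contra! hc
    exact hz ((Module.forall_dual_apply_eq_zero_iff ℝ z).1 hc)
  exact ⟨(f z)⁻¹ • f, by simp [hf]⟩

/-- A member of a generating list of minimal length does not commute with all other members. -/
lemma GeneratesOver.exists_lie_ne_zero [FiniteDimensional ℝ g] (hZ : IsDerivedCenter Z) {x : g}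
    {l : List g} (h : GeneratesOver Z (x :: l)) (hlen : finrank ℝ Z + l.length < finrank ℝ g) :
    ∃ y ∈ l, ⁅x, y⁆ ≠ 0 := by
  by_contra! hc
  have hx : x ∈ Z := hZ.mem_of_central x (h.lie_eq_zero hZ.lie_eq_zero (by simpa using hc))
  have : GeneratesOver Z l := fun S hS hl => h S hS fun y hy => by
    rcases List.mem_cons.1 hy with rfl | hy
    exacts [hS hx, hl y hy]
  exact absurd this.finrank_le (by omega)

lemma GeneratesOver.exists_symplectic_pair [FiniteDimensional ℝ g] (hZ : IsDerivedCenter Z)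
    {z : g} {l : Dual ℝ g} (hl : ∀ x y : g, ⁅x, y⁆ = l ⁅x, y⁆ • z) (hlz : l z = 1) {x : g}
    {rest pre : List g} (h : GeneratesOver Z (x :: (rest ++ pre)))
    (hlen : finrank ℝ Z + (rest.length + pre.length) < finrank ℝ g)
    (horth : ∀ p ∈ pre, ∀ y ∈ x :: rest, ⁅p, y⁆ = 0) :
    ∃ (y : g) (rest' : List g), rest'.length + 1 = rest.length ∧ ⁅x, y⁆ = z ∧
      GeneratesOver Z (rest' ++ (x :: y :: pre)) ∧
      (∀ p ∈ x :: y :: pre, ∀ q ∈ rest', ⁅p, q⁆ = 0) ∧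
      ∀ p ∈ pre, ⁅p, y⁆ = 0 := by
  obtain ⟨y₀, hy₀, hne⟩ := h.exists_lie_ne_zero hZ (by simpa using hlen)
  have hy₀ : y₀ ∈ rest := by
    rcases List.mem_append.1 hy₀ with hy | hy
    · exact hy
    · exact absurd (by rw [← lie_skew, horth y₀ hy x List.mem_cons_self, neg_zero]) hne
  have hω : l ⁅x, y₀⁆ ≠ 0 := fun h0 => hne (by rw [hl, h0, zero_smul])
  obtain ⟨s, t, rfl⟩ := List.append_of_mem hy₀
  set y := (l ⁅x, y₀⁆)⁻¹ • y₀ with hy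
  have hxy : ⁅x, y⁆ = z := by
    rw [hy, lie_smul, hl x y₀, smul_smul]
    simp [hlz, hω]
  have hy₀y : y₀ = l ⁅x, y₀⁆ • y := by simp [hy, smul_smul, hω]
  let π : g → g := fun q => q - l ⁅q, y⁆ • x + l ⁅q, x⁆ • y
  have hyx : ⁅y, x⁆ = -z := by rw [← lie_skew, hxy]
  refine ⟨y, (s ++ t).map π, by simp; omega, hxy, ?_, ?_, ?_⟩
  · intro S hS hm
    have hmx : x ∈ S := hm x (by simp)
    have hmy : y ∈ S := hm y (by simp)
    refine h S hS fun q hq => ?_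
    have hst (q : g) (hq : q ∈ s ++ t) : q ∈ S := by
      have h1 : π q ∈ S := hm _ (List.mem_append_left _ (List.mem_map_of_mem hq))
      have h2 : q = π q + l ⁅q, y⁆ • x - l ⁅q, x⁆ • y := by simp only [π]; abel
      rw [h2]
      exact S.sub_mem (S.add_mem h1 (S.smul_mem _ hmx)) (S.smul_mem _ hmy)
    simp only [List.mem_cons, List.mem_append] at hq hst
    rcases hq with rfl | (hq | rfl | hq) | hq
    · exact hmx
    · exact hst q (Or.inl hq)
    · rw [hy₀y]
      exact S.smul_mem _ hmy
    · exact hst q (Or.inr hq)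
    · exact hm q (by simp [hq])
  · intro p hp q' hq'
    obtain ⟨q, hq, rfl⟩ := List.mem_map.1 hq'
    have hqr : q ∈ x :: (s ++ y₀ :: t) := by
      simp only [List.mem_cons, List.mem_append] at hq ⊢
      tauto
    have hskew (u : g) : l ⁅q, u⁆ = -l ⁅u, q⁆ := by rw [← lie_skew, map_neg]
    simp only [π, lie_add, lie_sub, lie_smul, hskew]
    rcases List.mem_cons.1 hp with rfl | hp
    · rw [lie_self, hxy, hl p q]
      simp [hlz]
    rcases List.mem_cons.1 hp with rfl | hp
    · rw [lie_self, hyx, hl y q]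
      simp [hlz]
    · have hpy : ⁅p, y⁆ = 0 := by rw [hy, lie_smul, horth p hp y₀ (by simp), smul_zero]
      rw [horth p hp q hqr, horth p hp x List.mem_cons_self, hpy]
      simp
  · intro p hp
    rw [hy, lie_smul, horth p hp y₀ (by simp), smul_zero]

theorem IsDerivedCenter.admitsPurelyCoclosedG2_of_finrank_eq_one [FiniteDimensional ℝ g]
    (hZ : IsDerivedCenter Z) (hdim : finrank ℝ g = 7) (hr : finrank ℝ Z = 1) :
    AdmitsPurelyCoclosedG2 g := by
  obtain ⟨⟨z, hzZ⟩, hz0, hspan⟩ := finrank_eq_one_iff'.1 hr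
  have hz0 : z ≠ 0 := fun h => hz0 (Subtype.ext h)
  obtain ⟨l, hlz⟩ := exists_dual_apply_eq_one hz0
  have hzs (w : g) (hw : w ∈ Z) : w = l w • z := by
    obtain ⟨c, hc⟩ := hspan ⟨w, hw⟩
    have hc : c • z = w := congrArg Subtype.val hc
    rw [← hc]
    simp [hlz]
  have hl (x y : g) : ⁅x, y⁆ = l ⁅x, y⁆ • z := hzs _ (hZ.lie_mem x y)
  obtain ⟨L, hL, hgen⟩ := exists_generatesOver 6 Z (by omega)
  obtain ⟨v₁, r₁, rfl⟩ := List.exists_cons_of_length_pos (l := L) (by omega)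
  obtain ⟨w₁, r₂, hr₂, hvw₁, hgen₁, ho₁, -⟩ := GeneratesOver.exists_symplectic_pair hZ hl hlz
    (x := v₁) (rest := r₁) (pre := []) (by simpa using hgen)
    (by simp at hL ⊢; omega) (by simp)
  obtain ⟨v₂, r₂, rfl⟩ := List.exists_cons_of_length_pos (l := r₂) (by simp at hL; omega)
  obtain ⟨w₂, r₃, hr₃, hvw₂, hgen₂, ho₂, hw₂⟩ := GeneratesOver.exists_symplectic_pair hZ hl hlz
    hgen₁ (by simp at hL hr₂ ⊢; omega) ho₁
  obtain ⟨v₃, r₃, rfl⟩ := List.exists_cons_of_length_pos (l := r₃)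
    (by simp at hL hr₂ hr₃; omega)
  obtain ⟨w₃, r₄, hr₄, hvw₃, hgen₃, -, hw₃⟩ := GeneratesOver.exists_symplectic_pair hZ hl hlz
    hgen₂ (by simp at hL hr₂ hr₃ ⊢; omega) ho₂
  obtain rfl : r₄ = [] := List.eq_nil_of_length_eq_zero (by simp at hL hr₂ hr₃ hr₄; omega)
  obtain ⟨b, hb⟩ := exists_basis_of_spans hdim ![v₁, w₁, v₂, w₂, v₃, (-2 : ℝ) • w₃, z] (by
    intro S hS
    have hzS : z ∈ S := hS 6
    refine hgen₃ S (fun w hw => hzs w hw ▸ S.smul_mem _ hzS) ?_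
    have hw₃S : w₃ ∈ S := by
      have := S.smul_mem (-2⁻¹ : ℝ) (hS 5)
      simpa [smul_smul] using this
    simpa using ⟨hS 4, hw₃S, hS 2, hS 3, hS 0, hS 1⟩)
  simp only [List.mem_cons, List.not_mem_nil, or_false, forall_eq_or_imp,
    forall_eq] at ho₁ ho₂ hw₂ hw₃
  obtain ⟨b0, b1, b2, b3, b4, b5, b6⟩ : b 0 = v₁ ∧ b 1 = w₁ ∧ b 2 = v₂ ∧ b 3 = w₂ ∧ b 4 = v₃ ∧
      b 5 = (-2 : ℝ) • w₃ ∧ b 6 = z := ⟨hb 0, hb 1, hb 2, hb 3, hb 4, hb 5, hb 6⟩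
  refine admitsPurelyCoclosedG2_of_symplectic b ?_ ?_ ?_ ?_ ?_ ?_ ?_ ?_ ?_ ?_ ?_ ?_ ?_ ?_ ?_ ?_ <;>
    simp only [b0, b1, b2, b3, b4, b5, b6, lie_smul, hvw₁, hvw₂, hvw₃, ho₁, ho₂, hw₂, hw₃,
      smul_zero, hZ.lie_eq_zero z hzZ, implies_true]

end Reduced

section RankThree

/-- The determinant of the values of three functionals on three vectors. -/
def det₃ {V : Type*} [AddCommGroup V] [Module ℝ V] (l : Fin 3 → Dual ℝ V) (x y w : V) : ℝ :=
  (l 0 x * l 1 y - l 1 x * l 0 y) * l 2 w + (l 1 x * l 2 y - l 2 x * l 1 y) * l 0 w +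
    (l 2 x * l 0 y - l 0 x * l 2 y) * l 1 w

section Det

variable {V : Type*} [AddCommGroup V] [Module ℝ V] (l : Fin 3 → Dual ℝ V)

lemma det₃_rotate (x y w : V) : det₃ l x y w = det₃ l w x y := by
  simp only [det₃]
  ring

lemma det₃_swap (x y w : V) : det₃ l x y w = -det₃ l y x w := by
  simp only [det₃]
  ring

lemma det₃_self (x w : V) : det₃ l x x w = 0 := by
  simp only [det₃]
  ring

/-- The vectors that are dependent on `x` and `y`, as far as `l` can tell. -/
def det₃Ker (x y : V) : Submodule ℝ V :=
  LinearMap.ker ((l 0 x * l 1 y - l 1 x * l 0 y) • l 2 + (l 1 x * l 2 y - l 2 x * l 1 y) • l 0 +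
    (l 2 x * l 0 y - l 0 x * l 2 y) • l 1)

lemma mem_det₃Ker {x y w : V} : w ∈ det₃Ker l x y ↔ det₃ l x y w = 0 := by
  simp [det₃Ker, det₃]

lemma det₃_eq_zero_of_lt {n : ℕ} {e : Fin n → V}
    (h : ∀ i j k, i < j → j < k → det₃ l (e i) (e j) (e k) = 0) (i j k : Fin n) :
    det₃ l (e i) (e j) (e k) = 0 := by
  have h12 := det₃_swap l (e i) (e j) (e k)
  have h13 := det₃_swap l (e k) (e j) (e i)
  have h23 := det₃_swap l (e k) (e i) (e j)
  have r1 := det₃_rotate l (e i) (e j) (e k)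
  have r2 := det₃_rotate l (e k) (e i) (e j)
  have r3 := det₃_rotate l (e j) (e i) (e k)
  have r4 := det₃_rotate l (e i) (e k) (e j)
  have s (x y : V) : det₃ l x x y = 0 := det₃_self l x y
  rcases lt_trichotomy i j with hij | rfl | hij
  · rcases lt_trichotomy j k with hjk | rfl | hjk
    · exact h _ _ _ hij hjk
    · rw [r1, r2, s]
    · rcases lt_trichotomy i k with hik | rfl | hik
      · linarith [h _ _ _ hik hjk]
      · rw [r1, s]
      · linarith [h _ _ _ hik hij]
  · rw [s]
  · rcases lt_trichotomy i k with hik | rfl | hik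
    · linarith [h _ _ _ hij hik]
    · rw [r1, s]
    · rcases lt_trichotomy j k with hjk | rfl | hjk
      · linarith [h _ _ _ hjk hik]
      · rw [r1, r2, s]
      · linarith [h _ _ _ hjk hij]

end Det

lemma GeneratesOver.trans {V : Type*} [AddCommGroup V] [Module ℝ V] {Z : Submodule ℝ V}
    {l l' : List V} (h : GeneratesOver Z l)
    (h' : ∀ S : Submodule ℝ V, (∀ x ∈ l', x ∈ S) → ∀ x ∈ l, x ∈ S) : GeneratesOver Z l' :=
  fun S hS hl => h S hS (h' S hl)

variable {Z : Submodule ℝ g} (l : Fin 3 → Dual ℝ g)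

/-- The self-dual parts of the brackets of `a, b, c, d`, with `a, b, c, d` regarded as an oriented
orthonormal basis, are dependent as far as `l` can tell. -/
def SelfDualDegenerate (a b c d : g) : Prop :=
  det₃ l (⁅a, b⁆ + ⁅c, d⁆) (⁅a, c⁆ + ⁅d, b⁆) (⁅a, d⁆ + ⁅b, c⁆) = 0

variable {l}

lemma det₃_star_and_triangle
    (H : ∀ a b c d : g, GeneratesOver Z [a, b, c, d] → SelfDualDegenerate l a b c d)
    {a b c d : g} (hgen : GeneratesOver Z [a, b, c, d]) :
    det₃ l ⁅a, b⁆ ⁅a, c⁆ ⁅a, d⁆ = 0 ∧ det₃ l ⁅b, c⁆ ⁅c, d⁆ ⁅d, b⁆ = 0 := by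
  have hs (s : ℝ) (hs : s ≠ 0) : SelfDualDegenerate l (s • a) b c d :=
    H _ _ _ _ (hgen.trans fun S hS => by
      simp only [List.mem_cons, List.not_mem_nil, or_false, forall_eq_or_imp, forall_eq] at hS ⊢
      exact ⟨(S.smul_mem_iff hs).1 hS.1, hS.2⟩)
  have h1 := hs 1 one_ne_zero
  have h2 := hs (-1) (by norm_num)
  have h3 := hs 2 (by norm_num)
  have h4 := hs (-2) (by norm_num)
  simp only [SelfDualDegenerate, det₃, smul_lie, map_add, map_smul, smul_eq_mul] at h1 h2 h3 h4 ⊢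
  constructor
  · linear_combination (1 / 12 : ℝ) * (h3 - h4) - (1 / 6 : ℝ) * (h1 - h2)
  · linear_combination (2 / 3 : ℝ) * (h1 + h2) - (1 / 6 : ℝ) * (h3 + h4)

lemma det₃_path
    (H : ∀ a b c d : g, GeneratesOver Z [a, b, c, d] → SelfDualDegenerate l a b c d)
    {a b c d : g} (hgen : GeneratesOver Z [a, b, c, d]) : det₃ l ⁅a, b⁆ ⁅b, c⁆ ⁅c, d⁆ = 0 := by
  have ht (s : ℝ) := (det₃_star_and_triangle H (a := a) (b := b) (c := c) (d := d + s • a)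
    (hgen.trans fun S hS => by
      simp only [List.mem_cons, List.not_mem_nil, or_false, forall_eq_or_imp, forall_eq] at hS ⊢
      exact ⟨hS.1, hS.2.1, hS.2.2.1, (S.add_mem_iff_left (S.smul_mem s hS.1)).1 hS.2.2.2⟩)).2
  have hs (s : ℝ) := (det₃_star_and_triangle H (a := b + s • c) (b := a) (c := c) (d := d)
    (hgen.trans fun S hS => by
      simp only [List.mem_cons, List.not_mem_nil, or_false, forall_eq_or_imp, forall_eq] at hS ⊢
      exact ⟨hS.2.1, (S.add_mem_iff_left (S.smul_mem s hS.2.2.1)).1 hS.1, hS.2.2⟩)).1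
  have t1 := ht 1
  have t2 := ht (-1)
  have s1 := hs 1
  have s2 := hs (-1)
  have hsk (i : Fin 3) (x y : g) : l i ⁅y, x⁆ = -l i ⁅x, y⁆ := by rw [← lie_skew, map_neg]
  simp only [det₃, smul_lie, lie_smul, add_lie, lie_add, map_add, map_smul, smul_eq_mul,
    hsk _ a b, hsk _ a c, hsk _ b d, lie_self, map_zero] at t1 t2 s1 s2 ⊢
  linear_combination (1 / 4 : ℝ) * (t1 - t2) - (1 / 4 : ℝ) * (s1 - s2)

lemma det₃_lie_eq_zero (hZc : ∀ z ∈ Z, ∀ x : g, ⁅x, z⁆ = 0)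
    (H : ∀ a b c d : g, GeneratesOver Z [a, b, c, d] → SelfDualDegenerate l a b c d)
    {v : Fin 4 → g} (hgen : GeneratesOver Z [v 0, v 1, v 2, v 3]) (x y x' y' x'' y'' : g) :
    det₃ l ⁅x, y⁆ ⁅x', y'⁆ ⁅x'', y''⁆ = 0 := by
  have hall : ∀ i j k m : Fin 4, [i, j, k, m].Nodup → ∀ n, n ∈ [i, j, k, m] := by decide
  have hperm (i j k m : Fin 4) (hn : [i, j, k, m].Nodup) :
      GeneratesOver Z [v i, v j, v k, v m] := hgen.trans fun S hS => by
    have hv (n : Fin 4) : v n ∈ S := hS _ (List.mem_map_of_mem (f := v) (hall i j k m hn n))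
    simp [hv]
  have hstar (i j k m : Fin 4) (hn : [i, j, k, m].Nodup) :=
    (det₃_star_and_triangle H (hperm i j k m hn)).1
  have htri (i j k m : Fin 4) (hn : [i, j, k, m].Nodup) :=
    (det₃_star_and_triangle H (hperm i j k m hn)).2
  have hpath (i j k m : Fin 4) (hn : [i, j, k, m].Nodup) := det₃_path H (hperm i j k m hn)
  let e : Fin 6 → g := ![⁅v 0, v 1⁆, ⁅v 0, v 2⁆, ⁅v 0, v 3⁆, ⁅v 1, v 2⁆, ⁅v 1, v 3⁆, ⁅v 2, v 3⁆]
  have hflip (i : Fin 3) : l i ⁅v 1, v 0⁆ = -l i ⁅v 0, v 1⁆ ∧ l i ⁅v 2, v 0⁆ = -l i ⁅v 0, v 2⁆ ∧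
      l i ⁅v 3, v 0⁆ = -l i ⁅v 0, v 3⁆ ∧ l i ⁅v 2, v 1⁆ = -l i ⁅v 1, v 2⁆ ∧
      l i ⁅v 3, v 1⁆ = -l i ⁅v 1, v 3⁆ ∧ l i ⁅v 3, v 2⁆ = -l i ⁅v 2, v 3⁆ := by
    simp only [← map_neg, lie_skew, and_self]
  have he : ∀ i j k, det₃ l (e i) (e j) (e k) = 0 := by
    refine det₃_eq_zero_of_lt l fun i j k hij hjk => ?_
    simp only [det₃] at hstar htri hpath ⊢
    fin_cases i <;> fin_cases j <;> first | exact absurd hij (by decide) | skip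
    all_goals fin_cases k <;> first | exact absurd hjk (by decide) | skip
    all_goals simp only [e, Fin.reduceFinMk, Fin.zero_eta, Fin.mk_one, Matrix.cons_val]
    · linear_combination (norm := ((try simp only [hflip]); ring1)) hstar 0 1 2 3 (by decide)
    · linear_combination (norm := ((try simp only [hflip]); ring1)) htri 3 0 1 2 (by decide)
    · linear_combination (norm := ((try simp only [hflip]); ring1)) hpath 2 0 1 3 (by decide)
    · linear_combination (norm := ((try simp only [hflip]); ring1)) -hpath 1 0 2 3 (by decide)
    · linear_combination (norm := ((try simp only [hflip]); ring1)) hpath 2 1 0 3 (by decide)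
    · linear_combination (norm := ((try simp only [hflip]); ring1)) htri 2 0 1 3 (by decide)
    · linear_combination (norm := ((try simp only [hflip]); ring1)) hpath 1 0 3 2 (by decide)
    · linear_combination (norm := ((try simp only [hflip]); ring1)) -hstar 1 0 2 3 (by decide)
    · linear_combination (norm := ((try simp only [hflip]); ring1)) hpath 0 1 2 3 (by decide)
    · linear_combination (norm := ((try simp only [hflip]); ring1)) -hpath 0 1 3 2 (by decide)
    · linear_combination (norm := ((try simp only [hflip]); ring1)) -hpath 1 2 0 3 (by decide)
    · linear_combination (norm := ((try simp only [hflip]); ring1)) hpath 1 3 0 2 (by decide)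
    · linear_combination (norm := ((try simp only [hflip]); ring1)) htri 1 0 2 3 (by decide)
    · linear_combination (norm := ((try simp only [hflip]); ring1)) -hpath 0 2 1 3 (by decide)
    · linear_combination (norm := ((try simp only [hflip]); ring1)) hstar 2 0 1 3 (by decide)
    · linear_combination (norm := ((try simp only [hflip]); ring1)) hpath 0 2 3 1 (by decide)
    · linear_combination (norm := ((try simp only [hflip]); ring1)) hpath 0 3 1 2 (by decide)
    · linear_combination (norm := ((try simp only [hflip]); ring1)) -hpath 0 3 2 1 (by decide)
    · linear_combination (norm := ((try simp only [hflip]); ring1)) -hstar 3 0 1 2 (by decide)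
    · linear_combination (norm := ((try simp only [hflip]); ring1)) htri 0 1 2 3 (by decide)
  have hlist {S : Submodule ℝ g} (h : ∀ i, e i ∈ S) :
      [v 0, v 1, v 2, v 3].Pairwise fun x y => ⁅x, y⁆ ∈ S := by
    simp only [List.pairwise_cons, List.mem_cons, List.not_mem_nil, or_false, forall_eq_or_imp,
      forall_eq, List.Pairwise.nil, IsEmpty.forall_iff, implies_true, and_true]
    exact ⟨⟨h 0, h 1, h 2⟩, ⟨h 3, h 4⟩, h 5⟩
  have h1 (i j) : det₃ l (e i) (e j) ⁅x'', y''⁆ = 0 :=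
    (mem_det₃Ker l).1 (hgen.lie_mem hZc (hlist fun k => (mem_det₃Ker l).2 (he i j k)) _ _)
  have h2 (i) : det₃ l ⁅x'', y''⁆ (e i) ⁅x', y'⁆ = 0 :=
    (mem_det₃Ker l).1 (hgen.lie_mem hZc (hlist fun j => (mem_det₃Ker l).2
      (by rw [← det₃_rotate, h1])) _ _)
  rw [det₃_rotate, det₃_rotate]
  exact (mem_det₃Ker l).1 (hgen.lie_mem hZc (hlist fun i => (mem_det₃Ker l).2
    (by rw [det₃_rotate, det₃_rotate, det₃_rotate, ← h2 i, det₃_rotate, det₃_rotate])) _ _)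

/-- Cramer's rule for three vectors of a space on which the three functionals `l` are jointly
injective. -/
lemma le_of_det₃_ne_zero {V : Type*} [AddCommGroup V] [Module ℝ V] {Z : Submodule ℝ V}
    {l : Fin 3 → Dual ℝ V} (hl : ∀ z ∈ Z, (∀ i, l i z = 0) → z = 0) {x y w : V} (hx : x ∈ Z)
    (hy : y ∈ Z) (hw : w ∈ Z) (hdet : det₃ l x y w ≠ 0) {S : Submodule ℝ V} (hxS : x ∈ S)
    (hyS : y ∈ S) (hwS : w ∈ S) : Z ≤ S := by
  intro z hz
  have hmem {T : Submodule ℝ V} (hx : x ∈ T) (hy : y ∈ T) (hw : w ∈ T) :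
      det₃ l z y w • x + det₃ l x z w • y + det₃ l x y z • w ∈ T :=
    T.add_mem (T.add_mem (T.smul_mem _ hx) (T.smul_mem _ hy)) (T.smul_mem _ hw)
  have h0 := hl _ (Z.sub_mem (Z.smul_mem (det₃ l x y w) hz) (hmem hx hy hw)) fun i => by
    fin_cases i <;>
    · simp only [Fin.zero_eta, Fin.mk_one, Fin.reduceFinMk, map_sub, map_add, map_smul,
        smul_eq_mul, det₃]
      ring
  rw [sub_eq_zero] at h0
  exact (S.smul_mem_iff hdet).1 (h0 ▸ hmem hxS hyS hwS)

theorem IsDerivedCenter.admitsPurelyCoclosedG2_of_finrank_eq_three [FiniteDimensional ℝ g]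
    (hZ : IsDerivedCenter Z) (hdim : finrank ℝ g = 7) (hr : finrank ℝ Z = 3) :
    AdmitsPurelyCoclosedG2 g := by
  let z : Basis (Fin 3) ℝ Z := finBasisOfFinrankEq ℝ Z hr
  choose l hl using fun i => LinearMap.exists_extend (z.coord i)
  have hlz (i : Fin 3) (w : Z) : l i w = z.coord i w := by rw [← hl i]; rfl
  have hinj (w : g) (hw : w ∈ Z) (h : ∀ i, l i w = 0) : w = 0 := by
    have : (⟨w, hw⟩ : Z) = 0 := z.ext_elem fun i => by
      rw [map_zero, Finsupp.zero_apply]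
      exact (hlz i ⟨w, hw⟩).symm.trans (h i)
    exact congrArg Subtype.val this
  obtain ⟨L, hL, hgen⟩ := exists_generatesOver 4 Z (by omega)
  obtain ⟨v₀, v₁, v₂, v₃, rfl⟩ := List.length_eq_four.1 hL
  obtain ⟨a, b, c, d, habcd, hne⟩ : ∃ a b c d : g, GeneratesOver Z [a, b, c, d] ∧
      ¬ SelfDualDegenerate l a b c d := by
    by_contra! H
    have h := det₃_lie_eq_zero (v := ![v₀, v₁, v₂, v₃]) hZ.lie_eq_zero H hgen
    have h1 (x y x' y' : g) : Z ≤ det₃Ker l ⁅x, y⁆ ⁅x', y'⁆ :=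
      hZ.le_of_lie_mem _ fun x'' y'' => (mem_det₃Ker l).2 (h _ _ _ _ _ _)
    have h2 (x y : g) (w : g) (hw : w ∈ Z) : Z ≤ det₃Ker l w ⁅x, y⁆ :=
      hZ.le_of_lie_mem _ fun x' y' => (mem_det₃Ker l).2
        (by rw [← det₃_rotate]; exact (mem_det₃Ker l).1 (h1 _ _ _ _ hw))
    have h3 (w w' : g) (hw : w ∈ Z) (hw' : w' ∈ Z) : Z ≤ det₃Ker l w w' :=
      hZ.le_of_lie_mem _ fun x y => (mem_det₃Ker l).2
        (by rw [det₃_swap, det₃_rotate, det₃_rotate, (mem_det₃Ker l).1 (h2 x y w hw hw'), neg_zero])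
    have h4 := (mem_det₃Ker l).1 (h3 (z 0) (z 1) (z 0).2 (z 1).2 (z 2).2)
    simp [det₃, hlz] at h4
  have hw₁ := Z.add_mem (hZ.lie_mem a b) (hZ.lie_mem c d)
  have hw₂ := Z.add_mem (hZ.lie_mem a c) (hZ.lie_mem d b)
  have hw₃ := Z.add_mem (hZ.lie_mem a d) (hZ.lie_mem b c)
  have hle {S : Submodule ℝ g} := le_of_det₃_ne_zero hinj hw₁ hw₂ hw₃ hne (S := S)
  obtain ⟨v, hv⟩ := exists_basis_of_spans hdim
    ![⁅a, c⁆ + ⁅d, b⁆, -(⁅a, d⁆ + ⁅b, c⁆), a, b, c, d, (-2⁻¹ : ℝ) • (⁅a, b⁆ + ⁅c, d⁆)] (by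
    intro S hS
    refine habcd S (hle ((S.smul_mem_iff (by norm_num : (-2⁻¹ : ℝ) ≠ 0)).1 (hS 6)) (hS 0)
      (neg_mem_iff.1 (hS 1))) ?_
    simpa using ⟨hS 2, hS 3, hS 4, hS 5⟩)
  obtain ⟨e0, e1, e2, e3, e4, e5, e6⟩ : v 0 = ⁅a, c⁆ + ⁅d, b⁆ ∧ v 1 = -(⁅a, d⁆ + ⁅b, c⁆) ∧
      v 2 = a ∧ v 3 = b ∧ v 4 = c ∧ v 5 = d ∧ v 6 = (-2⁻¹ : ℝ) • (⁅a, b⁆ + ⁅c, d⁆) :=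
    ⟨hv 0, hv 1, hv 2, hv 3, hv 4, hv 5, hv 6⟩
  have e6' : ⁅a, b⁆ + ⁅c, d⁆ = (-2 : ℝ) • v 6 := by rw [e6, smul_smul]; norm_num
  refine admitsPurelyCoclosedG2_of_selfDual v (fun i h0 h1 h6 x y => ?_) (fun x => ?_) ?_ ?_ ?_
  · refine hle (S := LinearMap.ker (v.coord i)) ?_ ?_ ?_ (hZ.lie_mem x y)
    · rw [e6']
      simp [h6.symm]
    · rw [← e0]
      simp [h0.symm]
    · rw [← neg_mem_iff, ← e1]
      simp [h1.symm]
  · rw [e0, e1, e6]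
    exact ⟨hZ.lie_eq_zero _ hw₂ x, hZ.lie_eq_zero _ (Z.neg_mem hw₃) x,
      hZ.lie_eq_zero _ (Z.smul_mem _ hw₁) x⟩
  · rw [e0, e2, e3, e4, e5]
  · rw [e1, e2, e3, e4, e5, neg_neg]
  · rw [← e6', e2, e3, e4, e5]

end RankThree

section RankTwo

variable {Z : Submodule ℝ g} {l m : Dual ℝ g} {z₁ z₂ n p a b c : g}

/-- `z₁, z₂` is a basis of `Z` whose dual basis extends to the functionals `l, m`. -/
structure IsFrame (Z : Submodule ℝ g) (l m : Dual ℝ g) (z₁ z₂ : g) : Prop where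
  fst_mem : z₁ ∈ Z
  snd_mem : z₂ ∈ Z
  l_fst : l z₁ = 1
  l_snd : l z₂ = 0
  m_fst : m z₁ = 0
  m_snd : m z₂ = 1
  eq : ∀ w ∈ Z, w = l w • z₁ + m w • z₂

lemma IsFrame.le (h : IsFrame Z l m z₁ z₂) {S : Submodule ℝ g} (h₁ : z₁ ∈ S) (h₂ : z₂ ∈ S) :
    Z ≤ S := fun w hw => by
  rw [h.eq w hw]
  exact S.add_mem (S.smul_mem _ h₁) (S.smul_mem _ h₂)

/-- A generating list `n, p, a, b, c` in which `n` only fails to commute with `p`, while `a` and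
`b` commute. -/
structure IsAdapted (Z : Submodule ℝ g) (z₂ n p a b c : g) : Prop where
  gen : GeneratesOver Z [n, p, a, b, c]
  lie_np : ⁅n, p⁆ = z₂
  lie_na : ⁅n, a⁆ = 0
  lie_nb : ⁅n, b⁆ = 0
  lie_nc : ⁅n, c⁆ = 0
  lie_ab : ⁅a, b⁆ = 0

lemma IsAdapted.eq_top (h : IsAdapted Z z₂ n p a b c) {S : Submodule ℝ g} (hZ : Z ≤ S)
    (hn : n ∈ S) (hp : p ∈ S) (ha : a ∈ S) (hb : b ∈ S) (hc : c ∈ S) : S = ⊤ :=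
  h.gen S hZ (by simpa using ⟨hn, hp, ha, hb, hc⟩)

lemma lie_eq_zero_symm {L : Type*} [LieRing L] {x y : L} (h : ⁅x, y⁆ = 0) : ⁅y, x⁆ = 0 := by
  rw [← lie_skew, h, neg_zero]

lemma lie_eq_neg_symm {L : Type*} [LieRing L] {x y z : L} (h : ⁅x, y⁆ = z) : ⁅y, x⁆ = -z := by
  rw [← lie_skew, h]

/-- The Lie algebra whose only brackets are `[c, a] = z₁`, `[c, b] = [n, p] = z₂`. -/
lemma IsAdapted.hasStructure27A (h : IsAdapted Z z₂ n p a b c) (hZ : IsDerivedCenter Z)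
    (hF : IsFrame Z l m z₁ z₂) (hdim : finrank ℝ g = 7) (hca : ⁅c, a⁆ = z₁) (hcb : ⁅c, b⁆ = z₂)
    (hpa : ⁅p, a⁆ = 0) (hpb : ⁅p, b⁆ = 0) (hpc : ⁅p, c⁆ = 0) : HasStructure27A g := by
  obtain ⟨v, hv⟩ := exists_basis_of_spans hdim ![c, a, n, b, p, -z₁, -z₂] fun S hS =>
    h.eq_top (hF.le (neg_mem_iff.1 (hS 5)) (neg_mem_iff.1 (hS 6))) (hS 2) (hS 4) (hS 1) (hS 3)
      (hS 0)
  obtain ⟨e0, e1, e2, e3, e4, e5, e6⟩ : v 0 = c ∧ v 1 = a ∧ v 2 = n ∧ v 3 = b ∧ v 4 = p ∧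
      v 5 = -z₁ ∧ v 6 = -z₂ := ⟨hv 0, hv 1, hv 2, hv 3, hv 4, hv 5, hv 6⟩
  refine hasStructure27A_of_basis v ?_ ?_ ?_ ?_ ?_ ?_ ?_ ?_ ?_ ?_ ?_ ?_ <;>
    simp only [e0, e1, e2, e3, e4, e5, e6, neg_neg, lie_neg, neg_eq_zero, hca, hcb, h.lie_np,
      h.lie_nb, h.lie_ab, lie_eq_zero_symm h.lie_na, lie_eq_zero_symm h.lie_nc,
      lie_eq_zero_symm hpa, lie_eq_zero_symm hpb, lie_eq_zero_symm hpc,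
      hZ.lie_eq_zero _ hF.fst_mem, hZ.lie_eq_zero _ hF.snd_mem, implies_true]

/-- The Lie algebra whose only brackets are `[c, a] = z₁`, `[c, b] = [n, p] = z₂` and
`[p, b] = t z₁`. -/
lemma IsAdapted.hasStructure27B (h : IsAdapted Z z₂ n p a b c) (hZ : IsDerivedCenter Z)
    (hF : IsFrame Z l m z₁ z₂) (hdim : finrank ℝ g = 7) (hca : ⁅c, a⁆ = z₁) (hcb : ⁅c, b⁆ = z₂)
    (hpa : ⁅p, a⁆ = 0) {t : ℝ} (ht : t ≠ 0) (hpb : ⁅p, b⁆ = t • z₁) (hpc : ⁅p, c⁆ = 0) :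
    HasStructure27B g := by
  obtain ⟨v, hv⟩ := exists_basis_of_spans hdim ![p, b, c, t • a, n, -(t • z₁), z₂] fun S hS =>
    h.eq_top (hF.le ((S.smul_mem_iff ht).1 (neg_mem_iff.1 (hS 5))) (hS 6)) (hS 4) (hS 0)
      ((S.smul_mem_iff ht).1 (hS 3)) (hS 1) (hS 2)
  obtain ⟨e0, e1, e2, e3, e4, e5, e6⟩ : v 0 = p ∧ v 1 = b ∧ v 2 = c ∧ v 3 = t • a ∧ v 4 = n ∧
      v 5 = -(t • z₁) ∧ v 6 = z₂ := ⟨hv 0, hv 1, hv 2, hv 3, hv 4, hv 5, hv 6⟩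
  refine hasStructure27B_of_basis v ?_ ?_ ?_ ?_ ?_ ?_ ?_ ?_ ?_ ?_ ?_ ?_ <;>
    simp only [e0, e1, e2, e3, e4, e5, e6, neg_neg, lie_neg, smul_lie, lie_smul, smul_zero,
      neg_zero, hca, lie_eq_neg_symm hcb, hpa, hpb, hpc, lie_eq_neg_symm h.lie_np,
      lie_eq_zero_symm h.lie_na, lie_eq_zero_symm h.lie_nb, lie_eq_zero_symm h.lie_nc,
      lie_eq_zero_symm h.lie_ab, hZ.lie_eq_zero _ hF.fst_mem, hZ.lie_eq_zero _ hF.snd_mem,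
      implies_true]

/-- The case where `[c, a] = z₁` and `[c, b] = z₂`. -/
lemma IsAdapted.of_lie_eq_frame (h : IsAdapted Z z₂ n p a b c) (hZ : IsDerivedCenter Z)
    (hF : IsFrame Z l m z₁ z₂) (hdim : finrank ℝ g = 7) (hca : ⁅c, a⁆ = z₁) (hcb : ⁅c, b⁆ = z₂)
    {γ₁ γ₂ γ₃ : ℝ} (hpa : ⁅p, a⁆ = γ₁ • z₁) (hpb : ⁅p, b⁆ = γ₂ • z₁) (hpc : ⁅p, c⁆ = γ₃ • z₁) :
    HasStructure27A g ∨ HasStructure27B g := by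
  have h' : IsAdapted Z z₂ n (p - γ₁ • c + γ₃ • a) a (b - γ₁ • n) c := by
    refine ⟨fun S hS hl => ?_, ?_, h.lie_na, ?_, h.lie_nc, ?_⟩
    · simp only [List.mem_cons, List.not_mem_nil, or_false, forall_eq_or_imp, forall_eq] at hl
      obtain ⟨hn, hp, ha, hb, hc⟩ := hl
      exact h.eq_top hS hn ((S.sub_mem_iff_left (S.smul_mem _ hc)).1
        ((S.add_mem_iff_left (S.smul_mem _ ha)).1 hp)) ha
        ((S.sub_mem_iff_left (S.smul_mem _ hn)).1 hb) hc
    · simp [h.lie_np, h.lie_nc, h.lie_na]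
    · simp [h.lie_nb]
    · simp [h.lie_ab, lie_eq_zero_symm h.lie_na]
  have hcb' : ⁅c, b - γ₁ • n⁆ = z₂ := by simp [hcb, lie_eq_zero_symm h.lie_nc]
  have hpa' : ⁅p - γ₁ • c + γ₃ • a, a⁆ = 0 := by simp [hpa, hca]
  have hpb' : ⁅p - γ₁ • c + γ₃ • a, b - γ₁ • n⁆ = γ₂ • z₁ := by
    simp [hpb, hcb, h.lie_ab, lie_eq_neg_symm h.lie_np, lie_eq_zero_symm h.lie_na,
      lie_eq_zero_symm h.lie_nc]
  have hpc' : ⁅p - γ₁ • c + γ₃ • a, c⁆ = 0 := by simp [hpc, lie_eq_neg_symm hca]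
  by_cases ht : γ₂ = 0
  · exact Or.inl (h'.hasStructure27A hZ hF hdim hca hcb' hpa' (by rw [hpb', ht, zero_smul]) hpc')
  · exact Or.inr (h'.hasStructure27B hZ hF hdim hca hcb' hpa' ht hpb' hpc')

/-- The Lie algebra whose only brackets are `[p, b] = z₁`, `[n, p] = z₂` and `[c, a]`. -/
lemma IsAdapted.hasStructure27A' (h : IsAdapted Z z₂ n p a b c) (hZ : IsDerivedCenter Z)
    (hF : IsFrame Z l m z₁ z₂) (hdim : finrank ℝ g = 7) (hca : ⁅c, a⁆ ≠ 0) (hcb : ⁅c, b⁆ = 0)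
    (hpa : ⁅p, a⁆ = 0) (hpb : ⁅p, b⁆ = z₁) (hpc : ⁅p, c⁆ = 0) : HasStructure27A g := by
  obtain ⟨α, β, hαβ⟩ : ∃ α β : ℝ, ⁅c, a⁆ = α • z₁ + β • z₂ := ⟨_, _, hF.eq _ (hZ.lie_mem _ _)⟩
  have hz := hZ.lie_eq_zero _ (hZ.lie_mem c a)
  by_cases hβ : β = 0
  · subst hβ
    rw [zero_smul, add_zero] at hαβ
    have hα : α ≠ 0 := fun h0 => hca (by rw [hαβ, h0, zero_smul])
    obtain ⟨v, hv⟩ := exists_basis_of_spans hdim ![p, n, c, α • b, a, z₂, -⁅c, a⁆] fun S hS =>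
      h.eq_top (hF.le ((S.smul_mem_iff hα).1 (hαβ ▸ neg_mem_iff.1 (hS 6))) (hS 5)) (hS 1) (hS 0)
        (hS 4) ((S.smul_mem_iff hα).1 (hS 3)) (hS 2)
    obtain ⟨e0, e1, e2, e3, e4, e5, e6⟩ : v 0 = p ∧ v 1 = n ∧ v 2 = c ∧ v 3 = α • b ∧ v 4 = a ∧
        v 5 = z₂ ∧ v 6 = -⁅c, a⁆ := ⟨hv 0, hv 1, hv 2, hv 3, hv 4, hv 5, hv 6⟩
    refine hasStructure27A_of_basis v ?_ ?_ ?_ ?_ ?_ ?_ ?_ ?_ ?_ ?_ ?_ ?_ <;>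
      simp only [e0, e1, e2, e3, e4, e5, e6, neg_neg, lie_neg, smul_lie, lie_smul, smul_zero,
        neg_zero, hcb, hpa, hpb, hpc, lie_eq_neg_symm h.lie_np, h.lie_na, h.lie_nb, h.lie_nc,
        lie_eq_zero_symm h.lie_ab, hZ.lie_eq_zero _ hF.snd_mem, hz, implies_true, ← hαβ]
  · have hz₂ {S : Submodule ℝ g} (h₁ : z₁ ∈ S) (h₃ : ⁅c, a⁆ ∈ S) : z₂ ∈ S := by
      rw [hαβ] at h₃
      exact (S.smul_mem_iff hβ).1 ((S.add_mem_iff_right (S.smul_mem _ h₁)).1 h₃)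
    obtain ⟨v, hv⟩ := exists_basis_of_spans hdim
      ![p, b, c, α • b - β • n, a, -z₁, -⁅c, a⁆] fun S hS =>
      h.eq_top (hF.le (neg_mem_iff.1 (hS 5)) (hz₂ (neg_mem_iff.1 (hS 5)) (neg_mem_iff.1 (hS 6))))
        ((S.smul_mem_iff hβ).1 ((S.sub_mem_iff_right (S.smul_mem _ (hS 1))).1 (hS 3))) (hS 0)
        (hS 4) (hS 1) (hS 2)
    obtain ⟨e0, e1, e2, e3, e4, e5, e6⟩ : v 0 = p ∧ v 1 = b ∧ v 2 = c ∧ v 3 = α • b - β • n ∧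
        v 4 = a ∧ v 5 = -z₁ ∧ v 6 = -⁅c, a⁆ := ⟨hv 0, hv 1, hv 2, hv 3, hv 4, hv 5, hv 6⟩
    refine hasStructure27A_of_basis v ?_ ?_ ?_ ?_ ?_ ?_ ?_ ?_ ?_ ?_ ?_ ?_ <;>
      simp only [e0, e1, e2, e3, e4, e5, e6, neg_neg, lie_neg, sub_lie, lie_sub, smul_lie,
        lie_smul, smul_zero, neg_zero, sub_zero, smul_neg, sub_neg_eq_add, hpa, hpb, hpc, lie_self,
        lie_eq_zero_symm hcb, hcb, lie_eq_neg_symm h.lie_np, h.lie_na, lie_eq_zero_symm h.lie_nb,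
        lie_eq_zero_symm h.lie_nc, lie_eq_zero_symm h.lie_ab,
        hZ.lie_eq_zero _ hF.fst_mem, hz, implies_true, ← hαβ]

/-- The case where `[c, b] = 0`. -/
lemma IsAdapted.of_lie_eq_zero [FiniteDimensional ℝ g] (h : IsAdapted Z z₂ n p a b c)
    (hZ : IsDerivedCenter Z) (hF : IsFrame Z l m z₁ z₂) (hdim : finrank ℝ g = 7)
    (hr : finrank ℝ Z = 2) (hcb : ⁅c, b⁆ = 0) {γ₁ γ₂ γ₃ : ℝ} (hpa : ⁅p, a⁆ = γ₁ • z₁)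
    (hpb : ⁅p, b⁆ = γ₂ • z₁) (hpc : ⁅p, c⁆ = γ₃ • z₁) : HasStructure27A g := by
  have hγ : γ₂ ≠ 0 := by
    rintro rfl
    have hgen : GeneratesOver Z [b, n, p, a, c] := h.gen.trans fun S hS => by
      simp only [List.mem_cons, List.not_mem_nil, or_false, forall_eq_or_imp, forall_eq] at hS ⊢
      tauto
    obtain ⟨y, hy, hne⟩ := hgen.exists_lie_ne_zero hZ (by simp [hdim, hr])
    rw [zero_smul] at hpb
    simp only [List.mem_cons, List.not_mem_nil, or_false] at hy
    rcases hy with rfl | rfl | rfl | rfl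
    exacts [hne (lie_eq_zero_symm h.lie_nb), hne (lie_eq_zero_symm hpb),
      hne (lie_eq_zero_symm h.lie_ab), hne (lie_eq_zero_symm hcb)]
  have hba := lie_eq_zero_symm h.lie_ab
  have h' : IsAdapted Z z₂ n p (a - (γ₁ * γ₂⁻¹) • b) (γ₂⁻¹ • b) (c - (γ₃ * γ₂⁻¹) • b) := by
    refine ⟨fun S hS hl => ?_, h.lie_np, ?_, ?_, ?_, ?_⟩
    · simp only [List.mem_cons, List.not_mem_nil, or_false, forall_eq_or_imp, forall_eq] at hl
      obtain ⟨hn, hp, ha, hb, hc⟩ := hl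
      have hb := (S.smul_mem_iff (inv_ne_zero hγ)).1 hb
      exact h.eq_top hS hn hp ((S.sub_mem_iff_left (S.smul_mem _ hb)).1 ha) hb
        ((S.sub_mem_iff_left (S.smul_mem _ hb)).1 hc)
    all_goals simp [h.lie_na, h.lie_nb, h.lie_nc, h.lie_ab]
  have hpa' : ⁅p, a - (γ₁ * γ₂⁻¹) • b⁆ = 0 := by
    rw [lie_sub, lie_smul, hpa, hpb, smul_smul, inv_mul_cancel_right₀ hγ, sub_self]
  have hpc' : ⁅p, c - (γ₃ * γ₂⁻¹) • b⁆ = 0 := by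
    rw [lie_sub, lie_smul, hpc, hpb, smul_smul, inv_mul_cancel_right₀ hγ, sub_self]
  have hpb' : ⁅p, γ₂⁻¹ • b⁆ = z₁ := by
    rw [lie_smul, hpb, smul_smul, inv_mul_cancel₀ hγ, one_smul]
  have hcb' : ⁅c - (γ₃ * γ₂⁻¹) • b, γ₂⁻¹ • b⁆ = 0 := by simp [hcb]
  refine h'.hasStructure27A' hZ hF hdim (fun h0 => ?_) hcb' hpa' hpb' hpc'
  have hgen := h'.gen
  set a' := a - (γ₁ * γ₂⁻¹) • b
  set b' := γ₂⁻¹ • b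
  set c' := c - (γ₃ * γ₂⁻¹) • b
  have hgen : GeneratesOver Z [a', n, p, b', c'] := hgen.trans fun S hS => by
    simp only [List.mem_cons, List.not_mem_nil, or_false, forall_eq_or_imp, forall_eq] at hS ⊢
    tauto
  obtain ⟨y, hy, hne⟩ := hgen.exists_lie_ne_zero hZ (by simp [hdim, hr])
  simp only [List.mem_cons, List.not_mem_nil, or_false] at hy
  rcases hy with rfl | rfl | rfl | rfl
  exacts [hne (lie_eq_zero_symm h'.lie_na), hne (lie_eq_zero_symm hpa'), hne h'.lie_ab,
    hne (lie_eq_zero_symm h0)]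

/-- The case where the brackets with `p` are multiples of `z₁`. -/
lemma IsAdapted.of_lie_eq_smul [FiniteDimensional ℝ g] (h : IsAdapted Z z₂ n p a b c)
    (hZ : IsDerivedCenter Z) (hF : IsFrame Z l m z₁ z₂) (hdim : finrank ℝ g = 7)
    (hr : finrank ℝ Z = 2) {γ₁ γ₂ γ₃ : ℝ} (hpa : ⁅p, a⁆ = γ₁ • z₁) (hpb : ⁅p, b⁆ = γ₂ • z₁)
    (hpc : ⁅p, c⁆ = γ₃ • z₁) : HasStructure27A g ∨ HasStructure27B g := by
  have hba := lie_eq_zero_symm h.lie_ab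
  obtain ⟨α, β, hca⟩ : ∃ α β : ℝ, ⁅c, a⁆ = α • z₁ + β • z₂ := ⟨_, _, hF.eq _ (hZ.lie_mem _ _)⟩
  obtain ⟨α', β', hcb⟩ : ∃ α β : ℝ, ⁅c, b⁆ = α • z₁ + β • z₂ := ⟨_, _, hF.eq _ (hZ.lie_mem _ _)⟩
  have hchange (s t s' t' : ℝ) (hst : s * t' - t * s' ≠ 0) :
      IsAdapted Z z₂ n p (s • a + t • b) (s' • a + t' • b) c := by
    refine ⟨fun S hS hl => ?_, h.lie_np, ?_, ?_, h.lie_nc, ?_⟩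
    · simp only [List.mem_cons, List.not_mem_nil, or_false, forall_eq_or_imp, forall_eq] at hl
      obtain ⟨hn, hp, ha, hb, hc⟩ := hl
      refine h.eq_top hS hn hp ((S.smul_mem_iff hst).1 ?_) ((S.smul_mem_iff hst).1 ?_) hc
      · convert S.sub_mem (S.smul_mem t' ha) (S.smul_mem t hb) using 1
        module
      · convert S.sub_mem (S.smul_mem s hb) (S.smul_mem s' ha) using 1
        module
    all_goals simp [h.lie_na, h.lie_nb, h.lie_ab, hba]
  have hpab (s t : ℝ) : ⁅p, s • a + t • b⁆ = (s * γ₁ + t * γ₂) • z₁ := by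
    rw [lie_add, lie_smul, lie_smul, hpa, hpb]
    module
  have hcab (s t : ℝ) : ⁅c, s • a + t • b⁆ = (s * α + t * α') • z₁ + (s * β + t * β') • z₂ := by
    rw [lie_add, lie_smul, lie_smul, hca, hcb]
    module
  by_cases hΔ : α * β' - β * α' = 0
  · left
    obtain ⟨s, t, s', t', hst, h1, h2⟩ : ∃ s t s' t' : ℝ, s * t' - t * s' ≠ 0 ∧
        s' * α + t' * α' = 0 ∧ s' * β + t' * β' = 0 := by
      by_cases hα : α' = 0
      · by_cases hβ : β' = 0
        · exact ⟨1, 0, 0, 1, by norm_num, by simp [hα], by simp [hβ]⟩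
        · exact ⟨0, 1, β', -β, by simpa using hβ, by linarith, by ring⟩
      · exact ⟨0, 1, α', -α, by simpa using hα, by ring, by linarith⟩
    exact (hchange s t s' t' hst).of_lie_eq_zero hZ hF hdim hr
      (by rw [hcab, h1, h2, zero_smul, zero_smul, add_zero]) (hpab _ _) (hpab _ _) hpc
  · refine (hchange (β' / (α * β' - β * α')) (-β / (α * β' - β * α')) (-α' / (α * β' - β * α'))
      (α / (α * β' - β * α')) ?_).of_lie_eq_frame hZ hF hdim ?_ ?_ (hpab _ _) (hpab _ _) hpc
    · have : β' / (α * β' - β * α') * (α / (α * β' - β * α')) -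
          -β / (α * β' - β * α') * (-α' / (α * β' - β * α')) = (α * β' - β * α')⁻¹ := by
        field_simp
      rw [this]
      exact inv_ne_zero hΔ
    · rw [hcab]
      convert add_zero z₁ using 2
      · convert one_smul ℝ z₁ using 2
        rw [div_mul_eq_mul_div, div_mul_eq_mul_div, ← add_div, div_eq_one_iff_eq hΔ]
        ring
      · convert zero_smul ℝ z₂ using 2
        ring
    · rw [hcab]
      convert zero_add z₂ using 2
      · convert zero_smul ℝ z₁ using 2
        ring
      · convert one_smul ℝ z₂ using 2
        rw [div_mul_eq_mul_div, div_mul_eq_mul_div, ← add_div, div_eq_one_iff_eq hΔ]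
        ring

lemma IsAdapted.hasStructure27A_or_27B [FiniteDimensional ℝ g] (h : IsAdapted Z z₂ n p a b c)
    (hZ : IsDerivedCenter Z) (hF : IsFrame Z l m z₁ z₂) (hdim : finrank ℝ g = 7)
    (hr : finrank ℝ Z = 2) : HasStructure27A g ∨ HasStructure27B g := by
  have hp (x : g) : ⁅p, x + m ⁅p, x⁆ • n⁆ = l ⁅p, x⁆ • z₁ := by
    rw [lie_add, lie_smul, lie_eq_neg_symm h.lie_np]
    nth_rw 1 [hF.eq _ (hZ.lie_mem p x)]
    module
  have h' : IsAdapted Z z₂ n p (a + m ⁅p, a⁆ • n) (b + m ⁅p, b⁆ • n) (c + m ⁅p, c⁆ • n) := by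
    refine ⟨fun S hS hl => ?_, h.lie_np, ?_, ?_, ?_, ?_⟩
    · simp only [List.mem_cons, List.not_mem_nil, or_false, forall_eq_or_imp, forall_eq] at hl
      obtain ⟨hn, hp, ha, hb, hc⟩ := hl
      exact h.eq_top hS hn hp ((S.add_mem_iff_left (S.smul_mem _ hn)).1 ha)
        ((S.add_mem_iff_left (S.smul_mem _ hn)).1 hb)
        ((S.add_mem_iff_left (S.smul_mem _ hn)).1 hc)
    all_goals simp [h.lie_na, h.lie_nb, h.lie_nc, h.lie_ab, lie_eq_zero_symm h.lie_na]
  exact h'.of_lie_eq_smul hZ hF hdim hr (hp a) (hp b) (hp c)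

/-- A functional cuts out of the bracket a form on the five-dimensional space `g ⧸ Z`; being
skew-symmetric, it is degenerate. -/
lemma IsDerivedCenter.exists_notMem_forall_apply_lie_eq_zero [FiniteDimensional ℝ g]
    (hZ : IsDerivedCenter Z) (hdim : finrank ℝ g = 7) (hr : finrank ℝ Z = 2) (l : Dual ℝ g) :
    ∃ n ∉ Z, ∀ x : g, l ⁅n, x⁆ = 0 := by
  have hq : finrank ℝ (g ⧸ Z) = 5 := by
    have := Z.finrank_quotient_add_finrank
    omega
  let q : Basis (Fin 5) ℝ (g ⧸ Z) := finBasisOfFinrankEq ℝ (g ⧸ Z) hq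
  choose x hx using fun i => Z.mkQ_surjective (q i)
  have hgen (S : Submodule ℝ g) (hS : Z ≤ S) (hxS : ∀ i, x i ∈ S) : S = ⊤ := by
    have htop : S.map Z.mkQ = ⊤ := by
      rw [← top_le_iff, ← q.span_eq, Submodule.span_le]
      rintro _ ⟨i, rfl⟩
      exact ⟨x i, hxS i, hx i⟩
    have := congrArg (Submodule.comap Z.mkQ) htop
    rwa [Submodule.comap_map_mkQ, sup_eq_right.2 hS, Submodule.comap_top] at this
  let A : Matrix (Fin 5) (Fin 5) ℝ := Matrix.of fun i j => l ⁅x i, x j⁆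
  have hA : A.transpose = -A := by
    ext i j
    simp only [A, Matrix.transpose_apply, Matrix.of_apply, Matrix.neg_apply]
    rw [← lie_skew, map_neg]
  have hdet : A.det = 0 := by
    have h := congrArg Matrix.det hA
    rw [Matrix.det_transpose, Matrix.det_neg] at h
    norm_num at h
    linarith
  obtain ⟨v, hv, hvA⟩ := Matrix.exists_vecMul_eq_zero_iff.2 hdet
  refine ⟨∑ i, v i • x i, fun hn => hv ?_, fun y => ?_⟩
  · have h0 : ∑ i, v i • q i = 0 := by
      rw [← (Submodule.Quotient.mk_eq_zero Z).2 hn, ← Z.mkQ_apply, map_sum]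
      exact Finset.sum_congr rfl fun i _ => by rw [map_smul, hx]
    exact funext (Fintype.linearIndependent_iff.1 q.linearIndependent v h0)
  · have htop := hgen (LinearMap.ker (l ∘ₗ (LieAlgebra.ad ℝ g (∑ i, v i • x i) : g →ₗ[ℝ] g)))
      (fun z hz => by simp [hZ.lie_eq_zero z hz]) fun j => by
        have := congrFun hvA j
        simpa [Matrix.vecMul, dotProduct, A, sum_lie] using this
    exact LinearMap.mem_ker.1 (htop ▸ Submodule.mem_top : y ∈ LinearMap.ker
      (l ∘ₗ (LieAlgebra.ad ℝ g (∑ i, v i • x i) : g →ₗ[ℝ] g)))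

/-- Given a linear relation between the brackets of `x, y, w` in which `[y, w]` occurs, these
generators can be replaced by ones adapted to `n, p`. -/
lemma GeneratesOver.isAdapted_of_relation {x y w : g} (h : GeneratesOver Z [n, p, x, y, w])
    (hnp : ⁅n, p⁆ = z₂) (hx : ⁅n, x⁆ = 0) (hy : ⁅n, y⁆ = 0) (hw : ⁅n, w⁆ = 0) {α β γ : ℝ}
    (hα : α ≠ 0) (hrel : α • ⁅y, w⁆ + β • ⁅w, x⁆ + γ • ⁅x, y⁆ = 0) :
    IsAdapted Z z₂ n p (α • y - β • x) (α • w - γ • x) x := by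
  refine ⟨fun S hS hl => ?_, hnp, ?_, ?_, hx, ?_⟩
  · simp only [List.mem_cons, List.not_mem_nil, or_false, forall_eq_or_imp, forall_eq] at hl
    obtain ⟨hn, hp, ha, hb, hc⟩ := hl
    refine h S hS ?_
    rw [S.sub_mem_iff_left (S.smul_mem _ hc), S.smul_mem_iff hα] at ha hb
    simpa using ⟨hn, hp, hc, ha, hb⟩
  · simp [hx, hy]
  · simp [hx, hw]
  · have : ⁅α • y - β • x, α • w - γ • x⁆ =
        α • (α • ⁅y, w⁆ + β • ⁅w, x⁆ + γ • ⁅x, y⁆) := by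
      simp only [lie_sub, sub_lie, lie_smul, smul_lie, lie_self]
      rw [← lie_skew y x, ← lie_skew x w]
      module
    rw [this, hrel, smul_zero]

theorem IsDerivedCenter.hasStructure27A_or_27B_of_finrank_eq_two [FiniteDimensional ℝ g]
    (hZ : IsDerivedCenter Z) (hdim : finrank ℝ g = 7) (hr : finrank ℝ Z = 2) :
    HasStructure27A g ∨ HasStructure27B g := by
  let z : Basis (Fin 2) ℝ Z := finBasisOfFinrankEq ℝ Z hr
  choose c hc using fun i => LinearMap.exists_extend (z.coord i)
  have hcz (i : Fin 2) (w : Z) : c i w = z.coord i w := by rw [← hc i]; rfl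
  have hw (w : g) (hw : w ∈ Z) : w = c 0 w • (z 0 : g) + c 1 w • (z 1 : g) := by
    have := congrArg Subtype.val (z.sum_repr ⟨w, hw⟩)
    rw [Fin.sum_univ_two] at this
    rw [hcz 0 ⟨w, hw⟩, hcz 1 ⟨w, hw⟩]
    exact this.symm
  obtain ⟨n, hn, hln⟩ := hZ.exists_notMem_forall_apply_lie_eq_zero hdim hr (c 0)
  obtain ⟨p, hp⟩ : ∃ p : g, ⁅n, p⁆ ≠ 0 := by
    by_contra! h
    exact hn (hZ.mem_of_central n h)
  have hcp : c 1 ⁅n, p⁆ ≠ 0 := fun h => hp (by rw [hw _ (hZ.lie_mem n p), hln, h]; simp)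
  have hnp (s : ℝ) : s • ⁅n, p⁆ = (s * c 1 ⁅n, p⁆) • (z 1 : g) := by
    conv_lhs => rw [hw _ (hZ.lie_mem n p), hln, zero_smul, zero_add, smul_smul]
  obtain ⟨m, hF⟩ : ∃ m, IsFrame Z (c 0) m (z 0) ⁅n, p⁆ := by
    refine ⟨(c 1 ⁅n, p⁆)⁻¹ • c 1, (z 0).2, hZ.lie_mem _ _, ?_, hln p, ?_, ?_, fun w hwZ => ?_⟩
    · simp [hcz]
    · simp [hcz]
    · simp [hcp]
    · rw [hnp, LinearMap.smul_apply, smul_eq_mul, mul_right_comm, inv_mul_cancel₀ hcp, one_mul]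
      exact hw w hwZ
  have hnx (x : g) : ⁅n, x⁆ = m ⁅n, x⁆ • ⁅n, p⁆ := by
    conv_lhs => rw [hF.eq _ (hZ.lie_mem n x), hln, zero_smul, zero_add]
  have h1 : Z < Z ⊔ ℝ ∙ n := left_lt_sup.2 (by rwa [Submodule.span_singleton_le_iff_mem])
  have h2 : Z ⊔ ℝ ∙ n < Z ⊔ ℝ ∙ n ⊔ ℝ ∙ p := by
    rw [left_lt_sup, Submodule.span_singleton_le_iff_mem]
    have hle : Z ⊔ ℝ ∙ n ≤ LinearMap.ker (LieAlgebra.ad ℝ g n : g →ₗ[ℝ] g) :=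
      sup_le (fun z hz => hZ.lie_eq_zero z hz n)
        ((Submodule.span_singleton_le_iff_mem _ _).2 (lie_self n))
    exact fun h => hp (hle h)
  have h1 := Submodule.finrank_lt_finrank_of_lt h1
  have h2 := Submodule.finrank_lt_finrank_of_lt h2
  obtain ⟨L, hL, hgen⟩ := exists_generatesOver 3 (Z ⊔ ℝ ∙ n ⊔ ℝ ∙ p) (by omega)
  obtain ⟨x₁, x₂, x₃, rfl⟩ := List.length_eq_three.1 hL
  let π : g → g := fun x => x - m ⁅n, x⁆ • p
  have hπ (x : g) : ⁅n, π x⁆ = 0 := by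
    rw [lie_sub, lie_smul, ← hnx, sub_self]
  have hgen' : GeneratesOver Z [n, p, π x₁, π x₂, π x₃] := by
    intro S hS hl
    simp only [List.mem_cons, List.not_mem_nil, or_false, forall_eq_or_imp, forall_eq, π] at hl
    obtain ⟨hnS, hpS, h1, h2, h3⟩ := hl
    rw [S.sub_mem_iff_left (S.smul_mem _ hpS)] at h1 h2 h3
    refine hgen S (sup_le (sup_le hS ?_) ?_) (by simpa using ⟨h1, h2, h3⟩)
    · rwa [Submodule.span_singleton_le_iff_mem]
    · rwa [Submodule.span_singleton_le_iff_mem]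
  have hx := hπ x₁
  have hy := hπ x₂
  have hw := hπ x₃
  generalize π x₁ = x, π x₂ = y, π x₃ = w at hgen' hx hy hw
  obtain ⟨t, ht, i, hi⟩ : ∃ t : Fin 3 → ℝ,
      ∑ i, t i • (![⟨⁅y, w⁆, hZ.lie_mem _ _⟩, ⟨⁅w, x⁆, hZ.lie_mem _ _⟩,
        ⟨⁅x, y⁆, hZ.lie_mem _ _⟩] : Fin 3 → Z) i = 0 ∧ ∃ i, t i ≠ 0 :=
    Fintype.not_linearIndependent_iff.1 fun h => by
      have := h.fintype_card_le_finrank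
      rw [hr, Fintype.card_fin] at this
      omega
  have hrel : t 0 • ⁅y, w⁆ + t 1 • ⁅w, x⁆ + t 2 • ⁅x, y⁆ = 0 := by
    simpa [Fin.sum_univ_three] using congrArg Subtype.val ht
  fin_cases i
  · exact (hgen'.isAdapted_of_relation rfl hx hy hw hi hrel).hasStructure27A_or_27B hZ hF hdim hr
  · have hrel' : t 1 • ⁅w, x⁆ + t 2 • ⁅x, y⁆ + t 0 • ⁅y, w⁆ = 0 := by
      rw [← hrel]
      abel
    refine (GeneratesOver.isAdapted_of_relation (hgen'.trans ?_) rfl hy hw hx hi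
      hrel').hasStructure27A_or_27B hZ hF hdim hr
    intro S hS
    simp only [List.mem_cons, List.not_mem_nil, or_false, forall_eq_or_imp, forall_eq] at hS ⊢
    tauto
  · have hrel' : t 2 • ⁅x, y⁆ + t 0 • ⁅y, w⁆ + t 1 • ⁅w, x⁆ = 0 := by
      rw [← hrel]
      abel
    refine (GeneratesOver.isAdapted_of_relation (hgen'.trans ?_) rfl hw hx hy hi
      hrel').hasStructure27A_or_27B hZ hF hdim hr
    intro S hS
    simp only [List.mem_cons, List.not_mem_nil, or_false, forall_eq_or_imp, forall_eq] at hS ⊢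
    tauto

end RankTwo

section Reduction

variable {Z : Submodule ℝ g}

lemma IsDerivedCenter.admits_or_hasStructure [FiniteDimensional ℝ g] (hZ : IsDerivedCenter Z)
    (hdim : finrank ℝ g = 7) (hr : 0 < finrank ℝ Z) :
    AdmitsPurelyCoclosedG2 g ∨ HasStructure27A g ∨ HasStructure27B g := by
  have hr3 : finrank ℝ Z ≤ 3 := by
    by_contra! h
    obtain ⟨L, hL, hgen⟩ := exists_generatesOver 3 Z (by omega)
    obtain ⟨a, b, c, rfl⟩ := List.length_eq_three.1 hL
    have hle : Z ≤ Submodule.span ℝ (Set.range ![⁅a, b⁆, ⁅a, c⁆, ⁅b, c⁆]) := by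
      have hmem (i : Fin 3) := Submodule.subset_span (R := ℝ)
        (Set.mem_range_self (f := ![⁅a, b⁆, ⁅a, c⁆, ⁅b, c⁆]) i)
      refine hZ.le_of_lie_mem _ (hgen.lie_mem hZ.lie_eq_zero ?_)
      simp only [List.pairwise_cons, List.mem_cons, List.not_mem_nil, or_false,
        forall_eq_or_imp, forall_eq, false_imp_iff, implies_true, List.Pairwise.nil, and_true]
      exact ⟨⟨hmem 0, hmem 1⟩, hmem 2⟩
    have h1 := Submodule.finrank_mono hle
    have h2 := finrank_range_le_card (R := ℝ) ![⁅a, b⁆, ⁅a, c⁆, ⁅b, c⁆]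
    rw [Set.finrank, Fintype.card_fin] at h2
    omega
  obtain h | h | h : finrank ℝ Z = 1 ∨ finrank ℝ Z = 2 ∨ finrank ℝ Z = 3 := by omega
  · exact Or.inl (hZ.admitsPurelyCoclosedG2_of_finrank_eq_one hdim h)
  · exact Or.inr (hZ.hasStructure27A_or_27B_of_finrank_eq_two hdim h)
  · exact Or.inl (hZ.admitsPurelyCoclosedG2_of_finrank_eq_three hdim h)

/-- A central vector outside a nonzero subspace `Z` that contains all brackets spans a direct
summand. -/
lemma mem_of_central_of_not_decomposable (hind : ¬ Decomposable g) (hZ0 : Z ≠ ⊥)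
    (hZ : ∀ x y : g, ⁅x, y⁆ ∈ Z) {n : g} (hn : ∀ x : g, ⁅n, x⁆ = 0) : n ∈ Z := by
  by_contra hnZ
  obtain ⟨l, hln, hl⟩ := Submodule.exists_le_ker_of_notMem hnZ
  let I : LieIdeal ℝ g :=
    { (ℝ ∙ n) with
      lie_mem := fun {x y} hy => by
        obtain ⟨t, rfl⟩ := Submodule.mem_span_singleton.1 hy
        rw [lie_smul, ← lie_skew, hn]
        simp }
  let J : LieIdeal ℝ g :=
    { LinearMap.ker l with
      lie_mem := fun {x y} _ => hl (hZ x y) }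
  have hI {y : g} : y ∈ I ↔ ∃ t : ℝ, t • n = y := Submodule.mem_span_singleton
  have hJ {y : g} : y ∈ J ↔ l y = 0 := LinearMap.mem_ker
  refine hind ⟨I, J, ?_, ?_, ?_, ?_⟩
  · intro h
    have : n ∈ I := hI.2 ⟨1, one_smul ℝ n⟩
    rw [h, LieSubmodule.mem_bot] at this
    exact hnZ (this ▸ Z.zero_mem)
  · obtain ⟨w, hw, hw0⟩ := Submodule.exists_mem_ne_zero_of_ne_bot hZ0
    intro h
    have : w ∈ J := hJ.2 (hl hw)
    rw [h, LieSubmodule.mem_bot] at this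
    exact hw0 this
  · rw [eq_bot_iff]
    intro y hy
    obtain ⟨hyI, hyJ⟩ := (LieSubmodule.mem_inf _ _ _).1 hy
    obtain ⟨t, rfl⟩ := hI.1 hyI
    have := hJ.1 hyJ
    rw [map_smul, smul_eq_mul, mul_eq_zero, or_iff_left hln] at this
    rw [this, zero_smul]
    exact LieSubmodule.zero_mem _
  · rw [eq_top_iff]
    intro y _
    refine (LieSubmodule.mem_sup _ _ _).2 ⟨(l y / l n) • n, hI.2 ⟨_, rfl⟩,
      y - (l y / l n) • n, hJ.2 ?_, add_sub_cancel _ _⟩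
    simp [hln]

lemma isDerivedCenter_span_lie (hind : ¬ Decomposable g)
    (hne : ∃ x y : g, ⁅x, y⁆ ≠ 0) (hstep : ∀ x y w : g, ⁅w, ⁅x, y⁆⁆ = 0) :
    IsDerivedCenter (Submodule.span ℝ {z : g | ∃ x y : g, ⁅x, y⁆ = z}) := by
  have hmem (x y : g) : ⁅x, y⁆ ∈ Submodule.span ℝ {z : g | ∃ x y : g, ⁅x, y⁆ = z} :=
    Submodule.subset_span ⟨x, y, rfl⟩
  refine ⟨hmem, fun z hz w => ?_, fun n hn => ?_, fun S hS => ?_⟩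
  · have hle : Submodule.span ℝ {z : g | ∃ x y : g, ⁅x, y⁆ = z} ≤
        LinearMap.ker (LieAlgebra.ad ℝ g w : g →ₗ[ℝ] g) :=
      Submodule.span_le.2 fun z ⟨x, y, hz⟩ => hz ▸ hstep x y w
    exact hle hz
  · obtain ⟨x, y, hxy⟩ := hne
    exact mem_of_central_of_not_decomposable hind
      (Submodule.ne_bot_iff _ |>.2 ⟨_, hmem x y, hxy⟩) hmem hn
  · exact Submodule.span_le.2 fun z ⟨x, y, hz⟩ => hz ▸ hS x y

end Reduction
/-- Theorem `2step-indecomposable-pure`.  A 7-dimensional indecomposable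
2-step real nilpotent Lie algebra admits a purely coclosed G₂-structure if and only if it is
isomorphic neither to `27A` nor to `27B`. -/
theorem two_step_indecomposable_pure (g : Type*) [LieRing g] [LieAlgebra ℝ g]
    (hdim : Module.finrank ℝ g = 7)
    (hind : ¬ Decomposable g)
    (hstep2 : LieModule.lowerCentralSeries ℝ g g 2 = ⊥)
    (hstep1 : LieModule.lowerCentralSeries ℝ g g 1 ≠ ⊥) :
    AdmitsPurelyCoclosedG2 g ↔ ¬ (HasStructure27A g ∨ HasStructure27B g) := by
  constructor
  · rintro ⟨b, d, hd, f, hf, -⟩ h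
    have hcc : AdmitsCoclosedG2 g := ⟨b, d, hd, f, hf⟩
    exact h.elim (fun h => h.not_admitsCoclosedG2 hcc) fun h => h.not_admitsCoclosedG2 hcc
  · intro h
    have : FiniteDimensional ℝ g := Module.finite_of_finrank_pos (by omega)
    have hmem (x y : g) : ⁅x, y⁆ ∈ LieModule.lowerCentralSeries ℝ g g 1 := by
      rw [LieModule.lowerCentralSeries_succ]
      exact LieSubmodule.lie_mem_lie (LieSubmodule.mem_top x) (LieSubmodule.mem_top y)
    have hstep (x y w : g) : ⁅w, ⁅x, y⁆⁆ = 0 := by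
      rw [← LieSubmodule.mem_bot (R := ℝ) (L := g), ← hstep2, LieModule.lowerCentralSeries_succ]
      exact LieSubmodule.lie_mem_lie (LieSubmodule.mem_top w) (hmem x y)
    have hne : ∃ x y : g, ⁅x, y⁆ ≠ 0 := by
      by_contra! h0
      refine hstep1 ?_
      rw [LieModule.lowerCentralSeries_succ, LieSubmodule.lieIdeal_oper_eq_span, eq_bot_iff,
        LieSubmodule.lieSpan_le]
      rintro _ ⟨x, y, rfl⟩
      exact h0 x y
    obtain ⟨x, y, hxy⟩ := hne
    have hZ := isDerivedCenter_span_lie hind ⟨x, y, hxy⟩ hstep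
    have hr := Submodule.one_le_finrank_iff.2
      ((Submodule.ne_bot_iff _).2 ⟨_, hZ.lie_mem x y, hxy⟩)
    exact (hZ.admits_or_hasStructure hdim hr).resolve_right h
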